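/- arXiv:1303.5188 — 4 statements merged into one kernel-verified Lean document; each statement's English description precedes it below -/
import Mathlib

section
/- With χ_{ij} = (μ∘det)·Ind_{T₀}^{G_l} ψ_{ij}, one has τ_l(χ_{ij}) = [G_l : T₀] · p^l · g_l(μ·(λ′)^{1+p^m i}) · g_l(μ·(λ′)^{p^m j}) for all integers i, j with 0 ≤ i, j < p^{n−1}(p−1). (Theorem 3.2: Gauss sums for the irreducible characters of G_l of degree p^{l−1}(p+1).) -/
noncomputable section
open Matrix Complex

/-- The additive character `x ↦ ζ_N^{r·x} = exp(2πi·r·x/N)` of `ZMod N`. -/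
def aChar (N : ℕ) (r : ℤ) (x : ZMod N) : ℂ :=
  Complex.exp (2 * Real.pi * Complex.I * (r : ℂ) * (x.val : ℂ) / (N : ℂ))

/-- The Gauss sum `τ_l(χ) = Σ_{X ∈ GL₂(ℤ/N)} χ(X) e(Tr X)` with `e = aChar N r`. -/
def tauGL (N : ℕ) [NeZero N] (r : ℤ) (χ : GL (Fin 2) (ZMod N) → ℂ) : ℂ :=
  ∑ X : GL (Fin 2) (ZMod N), χ X * aChar N r (Matrix.trace X.val)

/-- `(Ind_H^T ψ)(g) = |H|⁻¹ Σ_{x ∈ T, x g x⁻¹ ∈ H} ψ(x g x⁻¹)`; induction to the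
full group is the case `T = Set.univ`. -/
def indC (N : ℕ) [NeZero N] (H T : Set (GL (Fin 2) (ZMod N)))
    (ψ : GL (Fin 2) (ZMod N) → ℂ) (g : GL (Fin 2) (ZMod N)) : ℂ :=
  (Nat.card H : ℂ)⁻¹ *
    ∑ x : GL (Fin 2) (ZMod N), T.indicator (fun y => H.indicator ψ (y * g * y⁻¹)) x

/-- The Gauss sum `g_l(ν) = Σ_{x ∈ (ℤ/N)^×} ν(x) e(x)` with `e = aChar N r`. -/
def gSum (N : ℕ) [NeZero N] (r : ℤ) (ν : ZMod N → ℂ) : ℂ :=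
  ∑ x : (ZMod N)ˣ, ν (x : ZMod N) * aChar N r (x : ZMod N)

/-- `T₀ = {X ∈ GL₂(ℤ/p^l) : X₂₁ ∈ p^m·(ℤ/p^l), X₁₂ ∈ p^n·(ℤ/p^l)}`. -/
def T0set (p l m n : ℕ) : Set (GL (Fin 2) (ZMod (p ^ l))) :=
  {X | (∃ c : ZMod (p ^ l), X.val 1 0 = (p : ZMod (p ^ l)) ^ m * c) ∧
       (∃ b : ZMod (p ^ l), X.val 0 1 = (p : ZMod (p ^ l)) ^ n * b)}

theorem aChar_add (N : ℕ) [NeZero N] (r : ℤ) (x y : ZMod N) :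
    aChar N r (x + y) = aChar N r x * aChar N r y := by
  have key (z : ZMod N) : aChar N r z = ZMod.stdAddChar ((r : ZMod N) * z) := by
    have hz : (r : ZMod N) * z = ((r * (z.val : ℤ) : ℤ) : ZMod N) := by
      push_cast
      rw [ZMod.natCast_zmod_val]
    rw [hz, ZMod.stdAddChar_coe, aChar]
    push_cast
    congr 1
    ring
  rw [key, key, key, mul_add, AddChar.map_add_eq_mul]

theorem sum_mul_sum_conj {G : Type*} [Group G] [Fintype G] (f φ : G → ℂ)
    (hf : ∀ x g, f (x * g * x⁻¹) = f g) :
    ∑ g, f g * ∑ x, φ (x * g * x⁻¹) = Nat.card G * ∑ g, f g * φ g := by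
  simp_rw [Finset.mul_sum]
  rw [Finset.sum_comm]
  have h (x : G) : ∑ g, f g * φ (x * g * x⁻¹) = ∑ g, f g * φ g := by
    rw [← Equiv.sum_comp (MulAut.conj x).toEquiv (fun g => f g * φ g)]
    simp [hf]
  simp [h, Finset.mul_sum]

/-- If the products of the off-diagonal entries allowed by `A` and `B` vanish, an invertible
`2 × 2` matrix with such entries amounts to two diagonal units and a pair in `A × B`. -/
def glOffDiagEquiv {R : Type*} [CommRing R] (A B : Set R)
    (h : ∀ a ∈ A, ∀ b ∈ B, a * b = 0) :
    {X : GL (Fin 2) R // X.val 1 0 ∈ B ∧ X.val 0 1 ∈ A} ≃ (Rˣ × Rˣ) × (A × B) where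
  toFun X :=
    have hu : IsUnit (X.1.val 0 0 * X.1.val 1 1) := by
      have hd := (Matrix.isUnit_iff_isUnit_det _).1 X.1.isUnit
      rwa [Matrix.det_fin_two, h _ X.2.2 _ X.2.1, sub_zero] at hd
    ((isUnit_of_mul_isUnit_left hu |>.unit, isUnit_of_mul_isUnit_right hu |>.unit),
      (⟨_, X.2.2⟩, ⟨_, X.2.1⟩))
  invFun t :=
    ⟨Matrix.GeneralLinearGroup.mk'' !![(t.1.1 : R), t.2.1; t.2.2, (t.1.2 : R)] (by
      rw [Matrix.det_fin_two_of, h _ t.2.1.2 _ t.2.2.2, sub_zero]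
      exact t.1.1.isUnit.mul t.1.2.isUnit), by
      simp [Matrix.GeneralLinearGroup.mk'', Matrix.nonsingInvUnit]⟩
  left_inv X := by
    ext i j
    fin_cases i <;> fin_cases j <;> rfl
  right_inv t := by
    ext <;> simp [Matrix.GeneralLinearGroup.mk'', Matrix.nonsingInvUnit]

theorem card_multiples_prime_pow {p l m : ℕ} (hp : p.Prime) (h : m ≤ l) :
    Nat.card {x : ZMod (p ^ l) | ∃ c, x = (p : ZMod (p ^ l)) ^ m * c} = p ^ (l - m) := by
  have : NeZero (p ^ l) := ⟨pow_ne_zero _ hp.ne_zero⟩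
  have hs : {x : ZMod (p ^ l) | ∃ c, x = (p : ZMod (p ^ l)) ^ m * c} =
      (AddSubgroup.zmultiples ((p ^ m : ℕ) : ZMod (p ^ l)) : Set (ZMod (p ^ l))) := by
    ext x
    simp only [Set.mem_ofPred_eq, SetLike.mem_coe, AddSubgroup.mem_zmultiples_iff]
    constructor
    · rintro ⟨c, rfl⟩
      exact ⟨c.val, by simp [mul_comm]⟩
    · rintro ⟨k, rfl⟩
      exact ⟨k, by simp [mul_comm]⟩
  rw [hs]
  refine (Nat.card_zmultiples _).trans ?_
  rw [ZMod.addOrderOf_coe _ (pow_ne_zero _ hp.ne_zero), Nat.gcd_eq_right (pow_dvd_pow p h),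
    Nat.pow_div h hp.pos]

theorem sum_indicator_T0set {p l m n : ℕ} [Fact p.Prime] (hmn : m + n = l)
    (φ : GL (Fin 2) (ZMod (p ^ l)) → ℂ) (f g : ZMod (p ^ l) → ℂ)
    (hφ : ∀ X ∈ T0set p l m n, IsUnit (X.val 0 0) → IsUnit (X.val 1 1) →
      X.val.det = X.val 0 0 * X.val 1 1 → φ X = f (X.val 0 0) * g (X.val 1 1)) :
    ∑ X, (T0set p l m n).indicator φ X =
      (p : ℂ) ^ l * (∑ a : (ZMod (p ^ l))ˣ, f a) * ∑ d : (ZMod (p ^ l))ˣ, g d := by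
  classical
  let M (k : ℕ) : Set (ZMod (p ^ l)) := {x | ∃ c, x = (p : ZMod (p ^ l)) ^ k * c}
  have hM : ∀ a ∈ M n, ∀ b ∈ M m, a * b = 0 := by
    rintro _ ⟨a, rfl⟩ _ ⟨b, rfl⟩
    have h0 : (p : ZMod (p ^ l)) ^ (m + n) = 0 := by
      rw [hmn]
      exact_mod_cast ZMod.natCast_self (p ^ l)
    linear_combination a * b * h0
  have hcard : Fintype.card (M n × M m) = p ^ l := by
    have hp := Fact.out (p := p.Prime)
    rw [← Nat.card_eq_fintype_card, Nat.card_prod, card_multiples_prime_pow hp (by omega),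
      card_multiples_prime_pow hp (by omega), ← pow_add]
    congr 1
    omega
  calc ∑ X, (T0set p l m n).indicator φ X
      = ∑ X : {X : GL (Fin 2) (ZMod (p ^ l)) // X.val 1 0 ∈ M m ∧ X.val 0 1 ∈ M n}, φ X := by
        simp only [Set.indicator_apply]
        rw [← Finset.sum_filter]
        exact Finset.sum_subtype _ (fun X => Finset.mem_filter_univ X) φ
    _ = ∑ t : ((ZMod (p ^ l))ˣ × (ZMod (p ^ l))ˣ) × (M n × M m), f t.1.1 * g t.1.2 := by
        refine Fintype.sum_equiv (glOffDiagEquiv (M n) (M m) hM) _ _ fun X => ?_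
        refine hφ X.1 X.2 (glOffDiagEquiv (M n) (M m) hM X).1.1.isUnit
          (glOffDiagEquiv (M n) (M m) hM X).1.2.isUnit ?_
        rw [Matrix.det_fin_two, hM _ X.2.2 _ X.2.1, sub_zero]
    _ = _ := by
        rw [Fintype.sum_prod_type]
        simp only [Finset.sum_const, Finset.card_univ, hcard, nsmul_eq_mul, Nat.cast_pow]
        rw [← Finset.mul_sum, Fintype.sum_prod_type, mul_assoc, Finset.sum_mul_sum]

/-- Theorem 3.2: for the irreducible characters `χ_{ij} = (μ∘det)·Ind_{T₀}^{G_l} ψ_{ij}`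
of degree `p^{l-1}(p+1)` one has
`τ_l(χ_{ij}) = [G_l : T₀] · p^l · g_l(μ·(λ')^{1+p^m i}) · g_l(μ·(λ')^{p^m j})`. -/
theorem gauss_sum_X1 (p l m n : ℕ) [Fact p.Prime] (hp : Odd p) (hl : 2 ≤ l)
    (hm : m = l / 2) (hn : n = l - l / 2)
    (r : ℤ) (hr : ¬ ((p : ℤ) ^ l ∣ r))
    (α u : ℤ) (hu : ¬ ((p : ℤ) ∣ u))
    (μ lam' : ZMod (p ^ l) → ℂ)
    (hμmul : ∀ x y : ZMod (p ^ l), IsUnit x → IsUnit y → μ (x * y) = μ x * μ y)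
    (hμne : ∀ x : ZMod (p ^ l), IsUnit x → μ x ≠ 0)
    (hμ : μ (1 + (p : ZMod (p ^ l)) ^ n) =
      aChar (p ^ l) 1 ((p : ZMod (p ^ l)) ^ n * (α : ZMod (p ^ l))))
    (hlmul : ∀ x y : ZMod (p ^ l), IsUnit x → IsUnit y → lam' (x * y) = lam' x * lam' y)
    (hlne : ∀ x : ZMod (p ^ l), IsUnit x → lam' x ≠ 0)
    (hlam : lam' (1 + (p : ZMod (p ^ l)) ^ n) =
      aChar (p ^ l) 1 ((p : ZMod (p ^ l)) ^ n * (u : ZMod (p ^ l))))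
    (i j : ℕ) (hi : i < p ^ (n - 1) * (p - 1)) (hj : j < p ^ (n - 1) * (p - 1)) :
    tauGL (p ^ l) r (fun X =>
        μ X.val.det *
          indC (p ^ l) (T0set p l m n) Set.univ
            (fun Y => lam' (Y.val 0 0) ^ (1 + p ^ m * i) * lam' (Y.val 1 1) ^ (p ^ m * j)) X)
      = ((Nat.card (GL (Fin 2) (ZMod (p ^ l))) : ℂ) / (Nat.card (T0set p l m n) : ℂ)) *
          (p : ℂ) ^ l *
          gSum (p ^ l) r (fun x => μ x * lam' x ^ (1 + p ^ m * i)) *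
          gSum (p ^ l) r (fun x => μ x * lam' x ^ (p ^ m * j)) := by
  have hmn : m + n = l := by omega
  generalize hψ : (fun Y : GL (Fin 2) (ZMod (p ^ l)) =>
    lam' (Y.val 0 0) ^ (1 + p ^ m * i) * lam' (Y.val 1 1) ^ (p ^ m * j)) = ψ
  have hconj := sum_mul_sum_conj
    (fun X : GL (Fin 2) (ZMod (p ^ l)) => μ X.val.det * aChar (p ^ l) r X.val.trace)
    ((T0set p l m n).indicator ψ)
    (fun x g => by
      simp only [Units.val_mul, Matrix.det_units_conj, Matrix.trace_units_conj])
  have hT := sum_indicator_T0set hmn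
    (fun X => (μ X.val.det * aChar (p ^ l) r X.val.trace) * ψ X)
    (fun x => μ x * lam' x ^ (1 + p ^ m * i) * aChar (p ^ l) r x)
    (fun x => μ x * lam' x ^ (p ^ m * j) * aChar (p ^ l) r x)
    (fun X _ h₀ h₁ hdet => by
      simp only [← hψ, hdet, hμmul _ _ h₀ h₁, Matrix.trace_fin_two, aChar_add]
      ring)
  simp only [Set.indicator_mul_right] at hT
  simp only [tauGL, gSum, indC, Set.indicator_univ]
  rw [mul_assoc _ (∑ x : (ZMod (p ^ l))ˣ, _), mul_assoc, ← mul_assoc ((p : ℂ) ^ l), ← hT,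
    div_mul_eq_mul_div, ← hconj, div_eq_inv_mul, Finset.mul_sum]
  refine Finset.sum_congr rfl fun X _ => ?_
  ring
end
end

section
/- If p | r, then τ_l(χ) = 0 for χ = (μ∘det)·Ind_T^{G_l} ψ. (Theorem 3.3(1): vanishing of Gauss sums for the degree-p^{l−1}(p−1) characters of G_l, l even, when p divides r.) -/
noncomputable section
open Matrix Complex

/-- The congruence set `K_k = {I + p^k B}` inside `GL₂(ℤ/p^l)`. -/
def Kset (p l k : ℕ) : Set (GL (Fin 2) (ZMod (p ^ l))) :=
  {X | ∃ B : Matrix (Fin 2) (Fin 2) (ZMod (p ^ l)),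
        X.val = 1 + ((p : ZMod (p ^ l)) ^ k) • B}

/-- `S = {[[a, εb],[b, a]]} ∩ GL₂(ℤ/p^l)`. -/
def Sset (p l ε : ℕ) : Set (GL (Fin 2) (ZMod (p ^ l))) :=
  {X | ∃ a b : ZMod (p ^ l), X.val = !![a, (ε : ZMod (p ^ l)) * b; b, a]}

/-- `T = K_m · S`. -/
def TKS (p l ε k : ℕ) : Set (GL (Fin 2) (ZMod (p ^ l))) :=
  {X | ∃ Y ∈ Kset p l k, ∃ Z ∈ Sset p l ε, X = Y * Z}

/-- `φ_A(X) = λ(Tr(A(X−I)))` with `λ = aChar (p^l) 1`. -/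
def phiA (p l : ℕ) (A : Matrix (Fin 2) (Fin 2) (ZMod (p ^ l)))
    (X : GL (Fin 2) (ZMod (p ^ l))) : ℂ :=
  aChar (p ^ l) 1 (Matrix.trace (A * (X.val - 1)))

lemma aChar_natCast (N : ℕ) [NeZero N] (r : ℤ) (k : ℕ) :
    aChar N r (k : ZMod N) =
      Complex.exp (2 * Real.pi * Complex.I * (r : ℂ) * (k : ℂ) / (N : ℂ)) := by
  have hN : (N : ℂ) ≠ 0 := Nat.cast_ne_zero.mpr (NeZero.ne N)
  rw [aChar, ZMod.val_natCast, Complex.exp_eq_exp_iff_exists_int]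
  refine ⟨-(r * (k / N : ℕ)), ?_⟩
  have hk : (k : ℂ) = (k % N : ℕ) + N * (k / N : ℕ) := by
    exact_mod_cast (Nat.mod_add_div k N).symm
  generalize k / N = q at hk ⊢
  rw [hk]
  push_cast
  field_simp
  ring

lemma aChar_add_of_dvd {p n : ℕ} [Fact p.Prime] {r : ℤ} (hr : (p : ℤ) ∣ r)
    (x t : ZMod (p ^ (n + 1))) :
    aChar (p ^ (n + 1)) r (x + (p : ZMod (p ^ (n + 1))) ^ n * t) = aChar (p ^ (n + 1)) r x := by
  have hp : (p : ℂ) ≠ 0 := Nat.cast_ne_zero.mpr (Fact.out : p.Prime).ne_zero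
  obtain ⟨s, rfl⟩ := hr
  have hcast : x + (p : ZMod (p ^ (n + 1))) ^ n * t =
      ((x.val + p ^ n * t.val : ℕ) : ZMod (p ^ (n + 1))) := by
    push_cast
    rw [ZMod.natCast_zmod_val, ZMod.natCast_zmod_val]
  rw [hcast, aChar_natCast, aChar, Complex.exp_eq_exp_iff_exists_int]
  refine ⟨s * t.val, ?_⟩
  push_cast
  field_simp
  ring

lemma aChar_one_pow_ne_one (p n : ℕ) [Fact p.Prime] :
    aChar (p ^ (n + 1)) 1 ((p : ZMod (p ^ (n + 1))) ^ n) ≠ 1 := by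
  have hp : (p : ℂ) ≠ 0 := Nat.cast_ne_zero.mpr (Fact.out : p.Prime).ne_zero
  rw [← Nat.cast_pow, aChar_natCast, Ne, Complex.exp_eq_one_iff]
  rintro ⟨k, hk⟩
  have h1 : (p : ℂ) ^ n * 1 = (p : ℂ) ^ n * (p * k) := by
    push_cast at hk
    field_simp at hk
    linear_combination hk
  have h2 : (1 : ℤ) = p * k := by exact_mod_cast mul_left_cancel₀ (pow_ne_zero n hp) h1
  have h3 : (p : ℤ) ∣ 1 := ⟨k, h2⟩
  exact (Fact.out : p.Prime).one_lt.ne' (by exact_mod_cast Int.eq_one_of_dvd_one (by positivity) h3)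

lemma Kset_mul {p l k : ℕ} {X Y : GL (Fin 2) (ZMod (p ^ l))}
    (hX : X ∈ Kset p l k) (hY : Y ∈ Kset p l k) : X * Y ∈ Kset p l k := by
  obtain ⟨B, hB⟩ := hX
  obtain ⟨C, hC⟩ := hY
  refine ⟨B + C + (p : ZMod (p ^ l)) ^ k • (B * C), ?_⟩
  rw [Units.val_mul, hB, hC]
  simp only [add_mul, mul_add, smul_add, smul_mul_assoc, mul_smul_comm, one_mul, mul_one]
  abel

lemma Kset_conj {p l k : ℕ} {Y : GL (Fin 2) (ZMod (p ^ l))} (Z : GL (Fin 2) (ZMod (p ^ l)))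
    (hY : Y ∈ Kset p l k) : Z * Y * Z⁻¹ ∈ Kset p l k := by
  obtain ⟨B, hB⟩ := hY
  refine ⟨Z.val * B * (Z⁻¹).val, ?_⟩
  rw [Units.val_mul, Units.val_mul, hB]
  simp only [add_mul, mul_add, smul_mul_assoc, mul_smul_comm, mul_one, Units.mul_inv]

lemma TKS_mul_Kset {p l ε k : ℕ} {X Y : GL (Fin 2) (ZMod (p ^ l))}
    (hX : X ∈ TKS p l ε k) (hY : Y ∈ Kset p l k) : X * Y ∈ TKS p l ε k := by
  obtain ⟨K, hK, Z, hZ, rfl⟩ := hX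
  exact ⟨K * (Z * Y * Z⁻¹), Kset_mul hK (Kset_conj Z hY), Z, hZ, by group⟩

lemma Kset_subset_TKS {p l ε k : ℕ} : Kset p l k ⊆ TKS p l ε k := fun Y hY =>
  ⟨Y, hY, 1, ⟨1, 0, by simp [Matrix.one_fin_two]⟩, by simp⟩

/-- The matrix `1 + c • E₀₁` as an element of `GL₂`. -/
def upperUnipotent {R : Type*} [CommRing R] (c : R) : GL (Fin 2) R where
  val := !![1, c; 0, 1]
  inv := !![1, -c; 0, 1]
  val_inv := by simp [Matrix.one_fin_two]
  inv_val := by simp [Matrix.one_fin_two]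

lemma upperUnipotent_val {R : Type*} [CommRing R] (c : R) :
    (upperUnipotent c).val = 1 + c • !![0, 1; 0, 0] := by
  simp [upperUnipotent, Matrix.one_fin_two]

lemma inv_upperUnipotent {R : Type*} [CommRing R] (c : R) :
    (upperUnipotent c)⁻¹ = upperUnipotent (-c) := by
  ext : 1
  simp [upperUnipotent]

lemma det_upperUnipotent {R : Type*} [CommRing R] (c : R) : (upperUnipotent c).val.det = 1 := by
  simp [upperUnipotent]

lemma upperUnipotent_mem_Kset {p l k : ℕ} (t : ZMod (p ^ l)) :
    upperUnipotent ((p : ZMod (p ^ l)) ^ k * t) ∈ Kset p l k :=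
  ⟨t • !![0, 1; 0, 0], by rw [upperUnipotent_val, smul_smul]⟩

lemma mul_upperUnipotent_mem_TKS_iff {p l ε k : ℕ} (X : GL (Fin 2) (ZMod (p ^ l)))
    (t : ZMod (p ^ l)) :
    X * upperUnipotent ((p : ZMod (p ^ l)) ^ k * t) ∈ TKS p l ε k ↔ X ∈ TKS p l ε k := by
  refine ⟨fun h => ?_, fun h => TKS_mul_Kset h (upperUnipotent_mem_Kset t)⟩
  have h' := TKS_mul_Kset h (upperUnipotent_mem_Kset (k := k) (-t))
  rwa [mul_neg, ← inv_upperUnipotent, mul_inv_cancel_right] at h'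

lemma phiA_upperUnipotent (p l ε : ℕ) (c : ZMod (p ^ l)) :
    phiA p l !![0, (ε : ZMod (p ^ l)); 1, 0] (upperUnipotent c) = aChar (p ^ l) 1 c := by
  simp [phiA, upperUnipotent_val, Matrix.trace_fin_two]

/-- Theorem 3.3(1): for `l = 2m` even and `χ = (μ∘det)·Ind_T^{G_l} ψ` of degree
`p^{l-1}(p-1)`, if `p ∣ r` then `τ_l(χ) = 0`. -/
theorem gauss_sum_X2_even_vanishing (p m : ℕ) [Fact p.Prime] (hp : Odd p) (hm : 1 ≤ m)
    (r : ℤ) (hr : ¬ ((p : ℤ) ^ (2 * m) ∣ r)) (hpr : (p : ℤ) ∣ r)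
    (α ε : ℕ) (hα : α < p ^ m) (hε : ε < p ^ m) (hres : ¬ IsSquare (ε : ZMod p))
    (μ : ZMod (p ^ (2 * m)) → ℂ)
    (hμmul : ∀ x y : ZMod (p ^ (2 * m)), IsUnit x → IsUnit y → μ (x * y) = μ x * μ y)
    (hμne : ∀ x : ZMod (p ^ (2 * m)), IsUnit x → μ x ≠ 0)
    (hμ : μ (1 + (p : ZMod (p ^ (2 * m))) ^ m) =
      aChar (p ^ (2 * m)) 1 ((p : ZMod (p ^ (2 * m))) ^ m * (α : ZMod (p ^ (2 * m)))))
    (ψ : GL (Fin 2) (ZMod (p ^ (2 * m))) → ℂ)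
    (hψmul : ∀ X Y : GL (Fin 2) (ZMod (p ^ (2 * m))),
      X ∈ TKS p (2 * m) ε m → Y ∈ TKS p (2 * m) ε m → ψ (X * Y) = ψ X * ψ Y)
    (hψne : ∀ X ∈ TKS p (2 * m) ε m, ψ X ≠ 0)
    (hψK : ∀ X ∈ Kset p (2 * m) m,
      ψ X = phiA p (2 * m) !![(0 : ZMod (p ^ (2 * m))), (ε : ZMod (p ^ (2 * m))); 1, 0] X) :
    tauGL (p ^ (2 * m)) r
      (fun X => μ X.val.det * indC (p ^ (2 * m)) (TKS p (2 * m) ε m) Set.univ ψ X) = 0 := by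
  obtain ⟨k, rfl⟩ : ∃ k, m = k + 1 := ⟨m - 1, by omega⟩
  set c : ZMod (p ^ (2 * (k + 1))) := (p : ZMod (p ^ (2 * (k + 1)))) ^ (2 * k + 1) with hc
  have hc' : c = (p : ZMod (p ^ (2 * (k + 1)))) ^ (k + 1) * (p : ZMod (p ^ (2 * (k + 1)))) ^ k := by
    rw [hc, ← pow_add]; congr 1; ring
  set Y := upperUnipotent c with hY
  have hYK : Y ∈ Kset p (2 * (k + 1)) (k + 1) := by
    rw [hY, hc']; exact upperUnipotent_mem_Kset _
  have hψY : ψ Y ≠ 1 := by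
    rw [hψK Y hYK, hY, phiA_upperUnipotent]
    exact aChar_one_pow_ne_one p (2 * k + 1)
  have hind : ∀ Z, (TKS p (2 * (k + 1)) ε (k + 1)).indicator ψ (Z * Y) =
      (TKS p (2 * (k + 1)) ε (k + 1)).indicator ψ Z * ψ Y := by
    intro Z
    have hiff : Z * Y ∈ TKS p (2 * (k + 1)) ε (k + 1) ↔ Z ∈ TKS p (2 * (k + 1)) ε (k + 1) := by
      rw [hY, hc']; exact mul_upperUnipotent_mem_TKS_iff Z _
    by_cases hZ : Z ∈ TKS p (2 * (k + 1)) ε (k + 1)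
    · rw [Set.indicator_of_mem (hiff.2 hZ), Set.indicator_of_mem hZ,
        hψmul Z Y hZ (Kset_subset_TKS hYK)]
    · rw [Set.indicator_of_notMem (mt hiff.1 hZ), Set.indicator_of_notMem hZ, zero_mul]
  have hsum : ∀ y : GL (Fin 2) (ZMod (p ^ (2 * (k + 1)))),
      ∑ X : GL (Fin 2) (ZMod (p ^ (2 * (k + 1)))), μ X.val.det *
        (TKS p (2 * (k + 1)) ε (k + 1)).indicator ψ (y * X * y⁻¹) *
        aChar (p ^ (2 * (k + 1))) r X.val.trace = 0 := by
    intro y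
    refine eq_zero_of_mul_eq_self_right hψY ?_
    rw [Finset.sum_mul]
    conv_rhs => rw [← Equiv.sum_comp (Equiv.mulRight (y⁻¹ * Y * y))]
    refine Finset.sum_congr rfl fun X _ => ?_
    have hdet : (X * (y⁻¹ * Y * y)).val.det = X.val.det := by
      have hy : (y⁻¹).val.det * y.val.det = 1 := by
        rw [← Matrix.det_mul, Units.inv_mul, Matrix.det_one]
      simp only [Units.val_mul, Matrix.det_mul, hY, det_upperUnipotent]
      linear_combination X.val.det * hy
    have htr : (X * (y⁻¹ * Y * y)).val.trace =
        X.val.trace + c * (X.val * ((y⁻¹).val * !![0, 1; 0, 0] * y.val)).trace := by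
      simp only [Units.val_mul, hY, upperUnipotent_val, mul_add, add_mul, mul_one, mul_smul_comm,
        smul_mul_assoc, Units.inv_mul, Matrix.trace_add, Matrix.trace_smul, smul_eq_mul]
    have hconj : y * (X * (y⁻¹ * Y * y)) * y⁻¹ = y * X * y⁻¹ * Y := by group
    have hchar : aChar (p ^ (2 * (k + 1))) r (X * (y⁻¹ * Y * y)).val.trace =
        aChar (p ^ (2 * (k + 1))) r X.val.trace := by
      rw [htr]; exact aChar_add_of_dvd (n := 2 * k + 1) hpr _ _
    rw [Equiv.coe_mulRight, hdet, hchar, hconj, hind]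
    ring
  simp only [tauGL, indC, Set.indicator_univ, Finset.mul_sum, Finset.sum_mul]
  rw [Finset.sum_comm]
  refine Finset.sum_eq_zero fun y _ => ?_
  rw [← mul_zero (Nat.card (TKS p (2 * (k + 1)) ε (k + 1)) : ℂ)⁻¹, ← hsum y, Finset.mul_sum]
  exact Finset.sum_congr rfl fun X _ => by ring
end
end

section
/- The class function ψ_φ := (1/p)·Ind_{N_{m+1}}^{T}(φ|_{N_{m+1}}) − Ind_{L}^{T} φ is the character of an irreducible finite-dimensional complex representation of T; moreover ψ_φ(I) = p and ψ_φ(X) = p·φ_{A₀}(X) for every X ∈ K_{m+1}. (Lemma 3.4.) -/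
noncomputable section
open Matrix Complex

/-- `N_{m+1} = {[[a, pεb+p^{m+1}c],[pb, a+p^{m+1}d]]} ∩ GL₂(ℤ/p^l)`. -/
def NsetOdd (p l ε m : ℕ) : Set (GL (Fin 2) (ZMod (p ^ l))) :=
  {X | ∃ a b c d : ZMod (p ^ l),
    X.val = !![a, (p : ZMod (p ^ l)) * (ε : ZMod (p ^ l)) * b + (p : ZMod (p ^ l)) ^ (m + 1) * c;
               (p : ZMod (p ^ l)) * b, a + (p : ZMod (p ^ l)) ^ (m + 1) * d]}

section RepresentationTheory

open Module

/-- The trace of an endomorphism is the sum of its traces on an invariant subspace and on the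
quotient by it. -/
lemma LinearMap.trace_eq_trace_restrict_add_trace_mapQ {K V : Type*} [Field K] [AddCommGroup V]
    [Module K V] [FiniteDimensional K V] (f : V →ₗ[K] V) (W : Submodule K V)
    (hW : ∀ v ∈ W, f v ∈ W) :
    LinearMap.trace K V f =
      LinearMap.trace K W (f.restrict hW) + LinearMap.trace K (V ⧸ W) (W.mapQ W f hW) := by
  obtain ⟨π, hπ⟩ := W.subtype.exists_leftInverse_of_injective W.ker_subtype
  obtain ⟨s, hs⟩ := W.mkQ.exists_rightInverse_of_surjective W.range_mkQ
  have hπ' : ∀ w : W, π w = w := fun w => congr($hπ w)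
  have hs' : ∀ q, W.mkQ (s q) = q := fun q => congr($hs q)
  have hmem : ∀ v, v - s (W.mkQ v) ∈ W := fun v => by
    rw [← Submodule.Quotient.mk_eq_zero, ← Submodule.mkQ_apply, map_sub, hs', sub_self]
  let r : V →ₗ[K] W := LinearMap.codRestrict W (LinearMap.id - s ∘ₗ W.mkQ) hmem
  have h1 : f = (f ∘ₗ W.subtype) ∘ₗ r + (f ∘ₗ s) ∘ₗ W.mkQ := by
    ext v
    simp [r]
  conv_lhs => rw [h1]
  rw [map_add, LinearMap.trace_comp_comm' r, LinearMap.trace_comp_comm' W.mkQ]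
  congr 2
  · ext w
    have : W.mkQ (f w) = 0 := by
      rw [Submodule.mkQ_apply, Submodule.Quotient.mk_eq_zero]
      exact hW _ w.2
    simp [r, -Submodule.mkQ_apply, this]
  · ext q
    have : W.mkQ (s (W.mkQ q)) = W.mkQ q := hs' _
    have h2 : W.mkQ (f (s (W.mkQ q))) = W.mkQ (f q) := by
      rw [← sub_eq_zero, ← map_sub, ← map_sub, Submodule.mkQ_apply, Submodule.Quotient.mk_eq_zero]
      apply hW
      rw [← Submodule.Quotient.mk_eq_zero, ← Submodule.mkQ_apply, map_sub, this, sub_self]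
    simpa using h2

namespace Representation

variable {G : Type} [Group G]
variable {V U : Type} [AddCommGroup V] [Module ℂ V] [FiniteDimensional ℂ V]
  [AddCommGroup U] [Module ℂ U] [FiniteDimensional ℂ U]

lemma sum_char_mul_char_inv [Fintype G] (ρ : Representation ℂ G V) (σ : Representation ℂ G U) :
    ∑ g, σ.character g * ρ.character g⁻¹ =
      (Nat.card G : ℂ) * finrank ℂ (IntertwiningMap ρ σ) := by
  have h0 : (Nat.card G : ℂ) ≠ 0 := by exact_mod_cast Nat.card_pos.ne'
  let _ := invertibleOfNonzero h0
  rw [← card_inv_mul_sum_char_mul_char_eq_finrank, mul_inv_cancel_left₀ h0]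

lemma finrank_intertwiningMap_self_pos [Nontrivial V] (ρ : Representation ℂ G V) :
    0 < finrank ℂ (IntertwiningMap ρ ρ) := by
  have : FiniteDimensional ℂ (IntertwiningMap ρ ρ) :=
    (invariantsEquivIntertwiningMap ρ ρ).finiteDimensional
  have : Nontrivial (IntertwiningMap ρ ρ) := by
    obtain ⟨v, hv⟩ := exists_ne (0 : V)
    refine ⟨0, IntertwiningMap.id ρ, fun h => hv ?_⟩
    simpa using congr($h.symm v)
  exact finrank_pos

lemma character_eq_add (ρ : Representation ℂ G V) (W : Submodule ℂ V)
    (hW : ∀ g, W ≤ W.comap (ρ g)) (g : G) :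
    ρ.character g = (ρ.subrepresentation W hW).character g + (ρ.quotient W hW).character g :=
  LinearMap.trace_eq_trace_restrict_add_trace_mapQ _ _ (hW g)

/-- A representation whose character has norm one is irreducible. -/
lemma eq_bot_or_eq_top_of_norm_character_eq_one [Fintype G] (ρ : Representation ℂ G V)
    (h : ∑ g, ρ.character g * ρ.character g⁻¹ = Nat.card G) (W : Submodule ℂ V)
    (hW : ∀ g, W ≤ W.comap (ρ g)) : W = ⊥ ∨ W = ⊤ := by
  by_contra! hne
  have : Nontrivial W := Submodule.nontrivial_iff_ne_bot.2 hne.1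
  have : Nontrivial (V ⧸ W) := Submodule.Quotient.nontrivial_iff.2 hne.2
  have h1 := finrank_intertwiningMap_self_pos (ρ.subrepresentation W hW)
  have h2 := finrank_intertwiningMap_self_pos (ρ.quotient W hW)
  simp only [character_eq_add ρ W hW, add_mul, mul_add, Finset.sum_add_distrib,
    sum_char_mul_char_inv, ← Nat.cast_add, ← Nat.cast_mul, Nat.cast_inj] at h
  simp only [← mul_add] at h
  have := Nat.eq_of_mul_eq_mul_left Nat.card_pos (h.trans (mul_one _).symm)
  omega

/-- A virtual character of norm one and positive degree is an irreducible character. -/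
theorem exists_irreducible_of_norm_eq_one [Fintype G] (ψ : G → ℂ)
    (hψ : ∑ g, ψ g * ψ g⁻¹ = Nat.card G) (ρ : Representation ℂ G V) (σ : Representation ℂ G U)
    (hsub : ∀ g, ρ.character g - σ.character g = ψ g) (hlt : finrank ℂ U < finrank ℂ V) :
    ∃ (d : ℕ) (_ : 0 < d) (τ : Representation ℂ G (Fin d → ℂ)),
      (∀ W : Submodule ℂ (Fin d → ℂ), (∀ g, ∀ v ∈ W, τ g v ∈ W) → W = ⊥ ∨ W = ⊤) ∧
      ∀ g, LinearMap.trace ℂ (Fin d → ℂ) (τ g) = ψ g := by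
  induction hn : finrank ℂ U using Nat.strong_induction_on generalizing V U with
  | _ n ih =>
  by_cases hf : ∃ f : IntertwiningMap σ ρ, f ≠ 0
  · obtain ⟨f, hf⟩ := hf
    have hker : ∀ g, LinearMap.ker f.toLinearMap ≤ (LinearMap.ker f.toLinearMap).comap (σ g) := by
      intro g v hv
      have hv' : f v = 0 := hv
      have := f.isIntertwining _ _ g v
      rw [hv', map_zero] at this
      exact this
    have hrange : ∀ g,
        LinearMap.range f.toLinearMap ≤ (LinearMap.range f.toLinearMap).comap (ρ g) := by
      rintro g _ ⟨v, rfl⟩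
      exact ⟨σ g v, f.isIntertwining _ _ g v⟩
    have hiso : ∀ g, (σ.quotient _ hker).character g =
        (ρ.subrepresentation _ hrange).character g := by
      intro g
      unfold character
      rw [← LinearMap.trace_conj' _ f.toLinearMap.quotKerEquivRange]
      congr 1
      ext x
      obtain ⟨x, rfl⟩ := f.toLinearMap.quotKerEquivRange.surjective x
      obtain ⟨x, rfl⟩ := Submodule.mkQ_surjective _ x
      simp only [LinearEquiv.conj_apply_apply, LinearEquiv.symm_apply_apply]
      exact f.isIntertwining _ _ g x
    have hr := LinearMap.finrank_range_add_finrank_ker f.toLinearMap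
    have hq := Submodule.finrank_quotient_add_finrank (LinearMap.range f.toLinearMap)
    have hpos : 0 < finrank ℂ (LinearMap.range f.toLinearMap) := by
      rw [finrank_pos_iff, Submodule.nontrivial_iff_ne_bot, Ne, LinearMap.range_eq_bot]
      intro h
      exact hf (IntertwiningMap.ext h)
    refine ih _ ?_ (ρ.quotient _ hrange) (σ.subrepresentation _ hker) ?_ ?_ rfl
    · omega
    · intro g
      rw [← hsub, character_eq_add ρ _ hrange, character_eq_add σ _ hker, hiso]
      ring
    · omega
  · push Not at hf
    have : Subsingleton (IntertwiningMap σ ρ) := ⟨fun a b => by rw [hf a, hf b]⟩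
    have : Nontrivial V := nontrivial_of_finrank_pos (R := ℂ) (by omega)
    have hcross : ∑ g, ρ.character g * σ.character g⁻¹ = 0 := by
      rw [sum_char_mul_char_inv, finrank_zero_of_subsingleton]
      simp
    have hcross' : ∑ g, σ.character g * ρ.character g⁻¹ = 0 := by
      rw [← hcross, ← Equiv.sum_comp (Equiv.inv G)]
      simp [mul_comm]
    have hU : finrank ℂ (IntertwiningMap σ σ) = 0 := by
      have h := hψ
      simp only [← hsub, sub_mul, mul_sub, Finset.sum_sub_distrib, hcross, hcross',
        sum_char_mul_char_inv, sub_zero, zero_sub, sub_neg_eq_add] at h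
      rw [← mul_add] at h
      norm_cast at h
      have := Nat.eq_of_mul_eq_mul_left Nat.card_pos (h.trans (mul_one _).symm)
      have := finrank_intertwiningMap_self_pos ρ
      omega
    have : Subsingleton U := by
      by_contra hU'
      rw [not_subsingleton_iff_nontrivial] at hU'
      exact (finrank_intertwiningMap_self_pos σ).ne' hU
    have hσ : ∀ g, σ.character g = 0 := fun g => by
      rw [character, Subsingleton.elim (σ g) 0, map_zero]
    let e := (finBasis ℂ V).equivFun
    let τ : Representation ℂ G (Fin (finrank ℂ V) → ℂ) :=
      (e.conjRingEquiv : End ℂ V →* End ℂ (Fin (finrank ℂ V) → ℂ)).comp ρ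
    have hτ : ∀ g, τ.character g = ψ g := by
      intro g
      rw [← hsub, hσ, sub_zero]
      exact LinearMap.trace_conj' (ρ g) e
    refine ⟨finrank ℂ V, finrank_pos, τ, fun W hW => ?_, hτ⟩
    refine eq_bot_or_eq_top_of_norm_character_eq_one τ ?_ W hW
    simpa only [hτ] using hψ

end Representation
end RepresentationTheory

section Induction

open Module MonoidAlgebra

variable {G : Type} [Group G]

/-- The left regular representation on the image of right multiplication by `e`. -/
def idempotentRep (e : MonoidAlgebra ℂ G) :
    Representation ℂ G (LinearMap.range (LinearMap.mulRight ℂ e)) :=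
  Representation.subrepresentation
    (((Algebra.lmul ℂ (MonoidAlgebra ℂ G)) : MonoidAlgebra ℂ G →* _).comp (of ℂ G))
    (LinearMap.range (LinearMap.mulRight ℂ e)) (by
      rintro g _ ⟨x, rfl⟩
      exact ⟨of ℂ G g * x, by simp [mul_assoc]⟩)

/-- The trace of `x ↦ g * x * a` on the group algebra. -/
def twistedTrace [Fintype G] (g : G) : MonoidAlgebra ℂ G →ₗ[ℂ] ℂ where
  toFun a := ∑ x, a.coeff (x⁻¹ * g⁻¹ * x)
  map_add' a b := by simp [Finset.sum_add_distrib]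
  map_smul' c a := by simp [Finset.mul_sum]

lemma twistedTrace_apply [Fintype G] (g : G) (a : MonoidAlgebra ℂ G) :
    twistedTrace g a = ∑ x, a.coeff (x⁻¹ * g⁻¹ * x) := rfl

lemma twistedTrace_conj [Fintype G] (g t : G) (a : MonoidAlgebra ℂ G) :
    twistedTrace g (of ℂ G t * a * of ℂ G t⁻¹) = twistedTrace g a := by
  have key (y : G) : (of ℂ G t * a * of ℂ G t⁻¹).coeff (t * y * t⁻¹) = a.coeff y := by
    rw [MonoidAlgebra.of_apply, MonoidAlgebra.of_apply, coeff_mul_single_mul,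
      coeff_single_mul_mul, one_mul, mul_one]
  rw [twistedTrace_apply, twistedTrace_apply, ← Equiv.sum_comp (Equiv.mulRight t⁻¹)]
  refine Finset.sum_congr rfl fun x _ => ?_
  rw [← key]
  simp [mul_assoc]

lemma character_idempotentRep [Fintype G] {e : MonoidAlgebra ℂ G} (he : e * e = e) (g : G) :
    (idempotentRep e).character g = twistedTrace g e := by
  classical
  let ι := (LinearMap.range (LinearMap.mulRight ℂ e)).subtype
  let π := (LinearMap.mulRight ℂ e).rangeRestrict
  let l := LinearMap.mulLeft ℂ (of ℂ G g)
  have h : idempotentRep e g = π ∘ₗ (l ∘ₗ ι) := by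
    ext x
    obtain ⟨_, x, rfl⟩ := x
    simp [idempotentRep, π, l, ι, mul_assoc, he, Representation.subrepresentation]
  rw [Representation.character, h, LinearMap.trace_comp_comm',
    LinearMap.trace_eq_matrix_trace ℂ (MonoidAlgebra.basis G ℂ), Matrix.trace]
  refine Finset.sum_congr rfl fun x _ => ?_
  simp [LinearMap.toMatrix_apply, π, l, ι, MonoidAlgebra.basis, mul_assoc]

/-- The idempotent projecting onto the `χ`-eigenspace of the image of `u`. -/
def charIdem {B : Type} [Group B] [Fintype B] (u : B →* G) (χ : B →* ℂ) : MonoidAlgebra ℂ G :=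
  (Fintype.card B : ℂ)⁻¹ • ∑ b, χ b⁻¹ • of ℂ G (u b)

section charIdem

variable {B : Type} [Group B] [Fintype B] (u : B →* G) (χ : B →* ℂ)

lemma of_mul_charIdem (b : B) : of ℂ G (u b) * charIdem u χ = χ b • charIdem u χ := by
  unfold charIdem
  rw [mul_smul_comm, smul_comm, Finset.mul_sum, Finset.smul_sum (r := χ b)]
  congr 1
  refine Fintype.sum_equiv (Equiv.mulLeft b) _ _ fun c => ?_
  rw [mul_smul_comm, ← map_mul, ← map_mul, smul_smul, mul_comm (χ b), ← map_mul]
  simp [mul_assoc, -map_mul, -map_inv₀]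

lemma charIdem_mul_of (b : B) : charIdem u χ * of ℂ G (u b) = χ b • charIdem u χ := by
  unfold charIdem
  rw [smul_mul_assoc, smul_comm, Finset.sum_mul, Finset.smul_sum (r := χ b)]
  congr 1
  refine Fintype.sum_equiv (Equiv.mulRight b) _ _ fun c => ?_
  rw [smul_mul_assoc, ← map_mul, ← map_mul, smul_smul, ← map_mul]
  simp [-map_mul, -map_inv₀]

lemma charIdem_mul_self : charIdem u χ * charIdem u χ = charIdem u χ := by
  conv_lhs => enter [1]; unfold charIdem
  rw [smul_mul_assoc, Finset.sum_mul]
  simp only [smul_mul_assoc, of_mul_charIdem, smul_smul, ← map_mul, inv_mul_cancel, map_one,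
    one_smul, Finset.sum_const, Finset.card_univ]
  rw [← Nat.cast_smul_eq_nsmul ℂ, smul_smul, inv_mul_cancel₀, one_smul]
  exact_mod_cast Fintype.card_ne_zero

lemma of_mul_charIdem_comm (t : G) (α : B ≃ B) (hu : ∀ b, u (α b) * t = t * u b)
    (hχ : ∀ b, χ (α b)⁻¹ = χ b⁻¹) : of ℂ G t * charIdem u χ = charIdem u χ * of ℂ G t := by
  unfold charIdem
  rw [mul_smul_comm, smul_mul_assoc, Finset.mul_sum, Finset.sum_mul]
  congr 1
  refine Fintype.sum_equiv α _ _ fun c => ?_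
  rw [mul_smul_comm, smul_mul_assoc, ← map_mul, ← map_mul, hu, hχ]

end charIdem

open Classical in
/-- The class function of `G` induced from the function `φ` on the subgroup `H`. -/
def inducedFun [Fintype G] (H : Subgroup G) (φ : G → ℂ) (g : G) : ℂ :=
  (Nat.card H : ℂ)⁻¹ * ∑ x, if x * g * x⁻¹ ∈ H then φ (x * g * x⁻¹) else 0

lemma twistedTrace_charIdem [Fintype G] (H : Subgroup G) [Fintype H] (χ : H →* ℂ) (φ : G → ℂ)
    (hφ : ∀ h : H, φ h = χ h) (g : G) :
    twistedTrace g (charIdem H.subtype χ) = inducedFun H φ g := by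
  classical
  have hc : ∀ y, (charIdem H.subtype χ).coeff y⁻¹ =
      (Nat.card H : ℂ)⁻¹ * if y ∈ H then φ y else 0 := by
    intro y
    rw [charIdem, Nat.card_eq_fintype_card]
    simp only [Subgroup.subtype_apply, MonoidAlgebra.of_apply, coeff_smul, coeff_sum,
      Finsupp.smul_apply, smul_eq_mul, Finsupp.finsetSum_apply, coeff_single, Finsupp.single_apply]
    congr 1
    split_ifs with hy
    · rw [Finset.sum_eq_single ⟨y⁻¹, inv_mem hy⟩]
      · rw [if_pos rfl, mul_one, hφ ⟨y, hy⟩]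
        exact congrArg χ (Subtype.ext (inv_inv y))
      · intro b _ hb
        rw [if_neg fun h => hb (Subtype.ext h), mul_zero]
      · simp
    · refine Finset.sum_eq_zero fun b _ => ?_
      rw [if_neg, mul_zero]
      rintro h
      exact hy (by simpa [h] using b.2)
  simp only [twistedTrace_apply, inducedFun]
  rw [Finset.mul_sum]
  refine Fintype.sum_equiv (Equiv.inv G) _ _ fun x => ?_
  rw [← hc]
  simp [mul_assoc]

end Induction

section FrobeniusPair

open Module MonoidAlgebra

variable {G : Type} [Group G] [Fintype G] {N L : Subgroup G} {φ : G → ℂ}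

lemma inducedFun_conj (H : Subgroup G) (φ : G → ℂ) (g t : G) :
    inducedFun H φ (t * g * t⁻¹) = inducedFun H φ g := by
  classical
  unfold inducedFun
  congr 1
  refine Fintype.sum_equiv (Equiv.mulRight t) _ _ fun x => ?_
  simp [mul_assoc]

lemma inducedFun_of_mem_normal [hN : N.Normal] (hNL : N ≤ L)
    (hstab : ∀ t, ∀ x ∈ N, φ (t * x * t⁻¹) = φ x) {g : G} (hg : g ∈ N) :
    inducedFun L φ g = (Nat.card L : ℂ)⁻¹ * Nat.card G * φ g := by
  classical
  have h : ∀ x, (if x * g * x⁻¹ ∈ L then φ (x * g * x⁻¹) else 0) = φ g := fun x => by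
    rw [if_pos (hNL (hN.conj_mem g hg x)), hstab x g hg]
  simp only [inducedFun, h, Finset.sum_const, Finset.card_univ, nsmul_eq_mul,
    Nat.card_eq_fintype_card]
  rw [mul_assoc]

lemma inducedFun_of_notMem_normal [hN : N.Normal] {g : G} (hg : g ∉ N) :
    inducedFun N φ g = 0 := by
  classical
  have h : ∀ x, (if x * g * x⁻¹ ∈ N then φ (x * g * x⁻¹) else 0) = 0 := fun x => by
    rw [if_neg]
    rwa [hN.mem_comm_iff, inv_mul_cancel_left]
  simp [inducedFun, h]

lemma inducedFun_of_malnormal (hmul : ∀ x ∈ L, ∀ y ∈ L, φ (x * y) = φ x * φ y)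
    (hone : φ 1 = 1) (hmal : ∀ h ∈ L, h ∉ N → ∀ x, x * h * x⁻¹ ∈ L → x ∈ L)
    {g : G} (hgL : g ∈ L) (hgN : g ∉ N) : inducedFun L φ g = φ g := by
  classical
  have h : ∀ x, (if x * g * x⁻¹ ∈ L then φ (x * g * x⁻¹) else 0) =
      if x ∈ L then φ g else 0 := fun x => by
    by_cases hx : x ∈ L
    · have hx' := inv_mem hx
      rw [if_pos (mul_mem (mul_mem hx hgL) hx'), if_pos hx, hmul _ (mul_mem hx hgL) _ hx',
        hmul _ hx _ hgL, mul_right_comm, ← hmul _ hx _ hx', mul_inv_cancel, hone, one_mul]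
    · rw [if_neg fun h => hx (hmal g hgL hgN x h), if_neg hx]
  have hcard : (Nat.card L : ℂ) ≠ 0 := by exact_mod_cast Nat.card_pos.ne'
  simp only [inducedFun, h]
  rw [← Finset.sum_filter, Finset.sum_const, ← Fintype.card_subtype, ← Nat.card_eq_fintype_card,
    nsmul_eq_mul]
  exact inv_mul_cancel_left₀ hcard _

open Classical in
lemma sum_ite_mem_one (H : Subgroup G) : ∑ g, (if g ∈ H then (1 : ℂ) else 0) = Nat.card H := by
  rw [← Finset.sum_filter, Finset.sum_const, ← Fintype.card_subtype, ← Nat.card_eq_fintype_card,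
    nsmul_eq_mul, mul_one]

open Classical in
lemma sum_inducedFun_off_normal [hN : N.Normal] (hNL : N ≤ L)
    (hmul : ∀ x ∈ L, ∀ y ∈ L, φ (x * y) = φ x * φ y) (hone : φ 1 = 1)
    (hmal : ∀ h ∈ L, h ∉ N → ∀ x, x * h * x⁻¹ ∈ L → x ∈ L) :
    ∑ g, (if g ∈ N then 0 else inducedFun L φ g * inducedFun L φ g⁻¹) =
      (Nat.card L : ℂ)⁻¹ * Nat.card G * (Nat.card L - Nat.card N) := by
  have h1 : ∀ g, (if g ∈ N then 0 else inducedFun L φ g * inducedFun L φ g⁻¹) =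
      (Nat.card L : ℂ)⁻¹ * ∑ x, if x * g * x⁻¹ ∈ L ∧ x * g * x⁻¹ ∉ N then
        φ (x * g * x⁻¹) * inducedFun L φ (x * g * x⁻¹)⁻¹ else 0 := by
    intro g
    have hinv : ∀ x, inducedFun L φ (x * g * x⁻¹)⁻¹ = inducedFun L φ g⁻¹ := fun x => by
      rw [← inducedFun_conj L φ g⁻¹ x]
      simp [mul_assoc]
    have hmem : ∀ x, x * g * x⁻¹ ∈ N ↔ g ∈ N := fun x => by
      rw [hN.mem_comm_iff, inv_mul_cancel_left]
    simp only [hinv, hmem]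
    by_cases hg : g ∈ N
    · simp [hg]
    · simp only [hg, if_false, not_false_eq_true, and_true]
      conv_lhs => enter [1]; unfold inducedFun
      rw [mul_assoc, Finset.sum_mul]
      simp only [ite_mul, zero_mul]
  simp only [h1]
  rw [← Finset.mul_sum, Finset.sum_comm]
  have h2 : ∀ x : G, ∑ g, (if x * g * x⁻¹ ∈ L ∧ x * g * x⁻¹ ∉ N then
        φ (x * g * x⁻¹) * inducedFun L φ (x * g * x⁻¹)⁻¹ else 0) =
      (Nat.card L : ℂ) - Nat.card N := by
    intro x
    rw [← sum_ite_mem_one, ← sum_ite_mem_one, ← Finset.sum_sub_distrib]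
    refine Fintype.sum_equiv (MulAut.conj x).toEquiv _ _ fun g => ?_
    simp only [MulEquiv.toEquiv_eq_coe, MulEquiv.coe_toEquiv, MulAut.conj_apply]
    obtain ⟨y, hy⟩ : ∃ y, x * g * x⁻¹ = y := ⟨_, rfl⟩
    simp only [hy]
    by_cases hyN : y ∈ N
    · simp [hyN, hNL hyN]
    · by_cases hyL : y ∈ L
      · rw [inducedFun_of_malnormal hmul hone hmal (inv_mem hyL) (by simpa using hyN),
          ← hmul _ hyL _ (inv_mem hyL)]
        simp [hyL, hyN, hone]
      · simp [hyL, hyN]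
  simp only [h2, Finset.sum_const, Finset.card_univ, nsmul_eq_mul, Nat.card_eq_fintype_card]
  ring

/-- The difference `q⁻¹ Ind_N φ - Ind_L φ`. -/
def frobeniusDiff (N L : Subgroup G) (φ : G → ℂ) (q : ℕ) (g : G) : ℂ :=
  1 / (q : ℂ) * inducedFun N φ g - inducedFun L φ g

variable {q : ℕ}

lemma frobeniusDiff_of_mem [N.Normal] (hNL : N ≤ L)
    (hstab : ∀ t, ∀ x ∈ N, φ (t * x * t⁻¹) = φ x) (hq : q ≠ 0)
    (hL : Nat.card G = q ^ 2 * Nat.card L) (hN : Nat.card L = (q + 1) * Nat.card N)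
    {g : G} (hg : g ∈ N) : frobeniusDiff N L φ q g = q * φ g := by
  have hcard : (Nat.card N : ℂ) ≠ 0 := by exact_mod_cast Nat.card_pos.ne'
  have hq' : (q : ℂ) ≠ 0 := by exact_mod_cast hq
  have hq'' : (q : ℂ) + 1 ≠ 0 := by exact_mod_cast q.succ_ne_zero
  rw [frobeniusDiff, inducedFun_of_mem_normal le_rfl hstab hg,
    inducedFun_of_mem_normal hNL hstab hg, hL, hN]
  push_cast
  field_simp
  ring

lemma sum_frobeniusDiff [N.Normal] (hNL : N ≤ L)
    (hmul : ∀ x ∈ L, ∀ y ∈ L, φ (x * y) = φ x * φ y) (hone : φ 1 = 1)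
    (hstab : ∀ t, ∀ x ∈ N, φ (t * x * t⁻¹) = φ x)
    (hmal : ∀ h ∈ L, h ∉ N → ∀ x, x * h * x⁻¹ ∈ L → x ∈ L) (hq : q ≠ 0)
    (hL : Nat.card G = q ^ 2 * Nat.card L) (hN : Nat.card L = (q + 1) * Nat.card N) :
    ∑ g, frobeniusDiff N L φ q g * frobeniusDiff N L φ q g⁻¹ = Nat.card G := by
  classical
  have h : ∀ g, frobeniusDiff N L φ q g * frobeniusDiff N L φ q g⁻¹ =
      (q : ℂ) ^ 2 * (if g ∈ N then 1 else 0) +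
        if g ∈ N then 0 else inducedFun L φ g * inducedFun L φ g⁻¹ := by
    intro g
    by_cases hg : g ∈ N
    · have hg' := inv_mem hg
      rw [frobeniusDiff_of_mem hNL hstab hq hL hN hg, frobeniusDiff_of_mem hNL hstab hq hL hN hg',
        mul_mul_mul_comm, ← hmul _ (hNL hg) _ (hNL hg'), mul_inv_cancel, hone]
      simp [hg, sq]
    · have hg' : g⁻¹ ∉ N := by simpa using hg
      simp [hg, frobeniusDiff, inducedFun_of_notMem_normal hg, inducedFun_of_notMem_normal hg']
  have hcard : (Nat.card L : ℂ) ≠ 0 := by exact_mod_cast Nat.card_pos.ne'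
  simp only [h]
  rw [Finset.sum_add_distrib, ← Finset.mul_sum, sum_ite_mem_one,
    sum_inducedFun_off_normal hNL hmul hone hmal, hL]
  push_cast
  field_simp
  ring

lemma twistedTrace_charIdem_mul [Fintype N] [N.Normal] (χ : N →* ℂ)
    (hφ : ∀ h : N, φ h = χ h) {B : Type} [Group B] [Fintype B] (u : B →* G) (χ' : B →* ℂ)
    (B₀ : Subgroup B) (hq : q ≠ 0) (hB : Nat.card B = q * Nat.card B₀)
    (hB₀ : ∀ b ∈ B₀, u b ∈ N ∧ φ (u b) = χ' b)
    (hcomm : ∀ t, of ℂ G t * charIdem N.subtype χ = charIdem N.subtype χ * of ℂ G t)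
    (hB₁ : ∀ b ∉ B₀, ∃ t, ∃ c ∈ N, t * u b * t⁻¹ = c * u b ∧ φ c ≠ 1) (g : G) :
    twistedTrace g (charIdem N.subtype χ * charIdem u χ') = 1 / (q : ℂ) * inducedFun N φ g := by
  classical
  set e := charIdem N.subtype χ with he
  have h0 : ∀ b ∈ B₀, e * of ℂ G (u b) = χ' b • e := by
    intro b hb
    obtain ⟨h1, h2⟩ := hB₀ b hb
    rw [← h2, hφ ⟨u b, h1⟩]
    exact charIdem_mul_of N.subtype χ ⟨u b, h1⟩
  have h1 : ∀ b ∉ B₀, twistedTrace g (e * of ℂ G (u b)) = 0 := by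
    intro b hb
    obtain ⟨t, c, hc, htc, hne⟩ := hB₁ b hb
    have h2 : of ℂ G t * (e * of ℂ G (u b)) * of ℂ G t⁻¹ = φ c • (e * of ℂ G (u b)) := by
      rw [← mul_assoc, hcomm, mul_assoc, mul_assoc, ← map_mul, ← map_mul, ← mul_assoc, htc,
        map_mul, ← mul_assoc, hφ ⟨c, hc⟩, ← smul_mul_assoc]
      congr 1
      exact charIdem_mul_of N.subtype χ ⟨c, hc⟩
    have h3 := twistedTrace_conj g t (e * of ℂ G (u b))
    rw [h2, map_smul, smul_eq_mul, ← sub_eq_zero, ← sub_one_mul] at h3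
    exact (mul_eq_zero.1 h3).resolve_left (sub_ne_zero.2 hne)
  have h2 : ∀ b, twistedTrace g (e * (χ' b⁻¹ • of ℂ G (u b))) =
      (if b ∈ B₀ then 1 else 0) * twistedTrace g e := by
    intro b
    rw [mul_smul_comm, map_smul]
    by_cases hb : b ∈ B₀
    · rw [h0 b hb, map_smul, smul_smul, ← map_mul]
      simp [hb]
    · rw [h1 b hb]
      simp [hb]
  have hcard : (Nat.card B₀ : ℂ) ≠ 0 := by exact_mod_cast Nat.card_pos.ne'
  have hq' : (q : ℂ) ≠ 0 := by exact_mod_cast hq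
  rw [← twistedTrace_charIdem N χ φ hφ]
  conv_lhs => enter [2, 2]; unfold charIdem
  rw [mul_smul_comm, map_smul, Finset.mul_sum, map_sum]
  simp only [h2]
  rw [← Finset.sum_mul, sum_ite_mem_one, ← Nat.card_eq_fintype_card, hB, smul_eq_mul]
  push_cast
  field_simp
  rw [he]

/-- Let `L / N` be a malnormal subgroup of order `q + 1` and index `q ^ 2` in `G / N` and let `φ` be
a linear character of `L` with `G`-stable restriction to `N`. If this restriction extends to a
subgroup containing `N` with index `q`, no element of which outside of `N` commutes with `G` modulo
the kernel of `φ`, then `q⁻¹ Ind_N φ - Ind_L φ` is an irreducible character. -/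
theorem exists_irreducible_frobeniusDiff [hNn : N.Normal] (hNL : N ≤ L)
    (hmul : ∀ x ∈ L, ∀ y ∈ L, φ (x * y) = φ x * φ y) (hone : φ 1 = 1)
    (hstab : ∀ t, ∀ x ∈ N, φ (t * x * t⁻¹) = φ x)
    (hmal : ∀ h ∈ L, h ∉ N → ∀ x, x * h * x⁻¹ ∈ L → x ∈ L) (hq : q ≠ 0)
    (hL : Nat.card G = q ^ 2 * Nat.card L) (hN : Nat.card L = (q + 1) * Nat.card N)
    {B : Type} [Group B] [Fintype B] (u : B →* G) (χ' : B →* ℂ)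
    (B₀ : Subgroup B) (hB : Nat.card B = q * Nat.card B₀)
    (hB₀ : ∀ b ∈ B₀, u b ∈ N ∧ φ (u b) = χ' b)
    (hB₁ : ∀ b ∉ B₀, ∃ t, ∃ c ∈ N, t * u b * t⁻¹ = c * u b ∧ φ c ≠ 1) :
    ∃ (d : ℕ) (_ : 0 < d) (τ : Representation ℂ G (Fin d → ℂ)),
      (∀ W : Submodule ℂ (Fin d → ℂ), (∀ g, ∀ v ∈ W, τ g v ∈ W) → W = ⊥ ∨ W = ⊤) ∧
      ∀ g, LinearMap.trace ℂ (Fin d → ℂ) (τ g) = frobeniusDiff N L φ q g := by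
  classical
  let χL : L →* ℂ := ⟨⟨fun x => φ x, hone⟩, fun x y => hmul x x.2 y y.2⟩
  let χN : N →* ℂ := χL.comp (Subgroup.inclusion hNL)
  have hcomm : ∀ t, of ℂ G t * charIdem N.subtype χN = charIdem N.subtype χN * of ℂ G t := by
    intro t
    refine of_mul_charIdem_comm _ _ t (MulAut.conjNormal t).toEquiv (fun b => ?_) fun b => ?_
    · simp
    · have := hstab t (b⁻¹ : N) (b⁻¹).2
      simpa [χN, χL, mul_assoc] using this
  have hidem : (charIdem N.subtype χN * charIdem u χ') * (charIdem N.subtype χN * charIdem u χ') =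
      charIdem N.subtype χN * charIdem u χ' := by
    have : Commute (charIdem N.subtype χN) (charIdem u χ') := by
      rw [charIdem.eq_def u]
      refine Commute.smul_right (Commute.sum_right _ _ _ fun b _ => Commute.smul_right ?_ _) _
      exact (hcomm (u b)).symm
    rw [this.symm.mul_mul_mul_comm, charIdem_mul_self, charIdem_mul_self]
  have hV := character_idempotentRep hidem
  have hU := character_idempotentRep (charIdem_mul_self L.subtype χL)
  simp only [twistedTrace_charIdem_mul χN (fun _ => rfl) u χ' B₀ hq hB hB₀ hcomm hB₁] at hV
  simp only [twistedTrace_charIdem L χL φ (fun _ => rfl)] at hU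
  have hsub : ∀ g, (idempotentRep (charIdem N.subtype χN * charIdem u χ')).character g -
      (idempotentRep (charIdem L.subtype χL)).character g = frobeniusDiff N L φ q g := by
    intro g
    rw [hV, hU, frobeniusDiff]
  refine Representation.exists_irreducible_of_norm_eq_one _
    (sum_frobeniusDiff hNL hmul hone hstab hmal hq hL hN) _ _ hsub ?_
  have h1 := hsub 1
  rw [Representation.char_one, Representation.char_one,
    frobeniusDiff_of_mem hNL hstab hq hL hN (one_mem N), hone, mul_one, sub_eq_iff_eq_add] at h1
  norm_cast at h1
  omega

end FrobeniusPair

section CongruenceSubgroup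

variable {R : Type} [CommRing R]

/-- The subgroup of matrices congruent modulo `d` to a matrix `[[a, εb],[b, a]]` whose lower left
entry is divisible by `d'`. -/
def congrSubgroup (ε d d' : R) : Subgroup (GL (Fin 2) R) where
  carrier := {X | d ∣ X 0 0 - X 1 1 ∧ d ∣ X 0 1 - ε * X 1 0 ∧ d' ∣ X 1 0}
  one_mem' := by simp
  mul_mem' := by
    rintro X Y ⟨h1, h2, h3⟩ ⟨h4, h5, h6⟩
    simp only [Set.mem_ofPred_eq, Matrix.GeneralLinearGroup.coe_mul, Matrix.mul_apply,
      Fin.sum_univ_two]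
    refine ⟨?_, ?_, (h3.mul_right _).add (h6.mul_left _)⟩
    · convert (((h1.mul_right (Y 0 0)).add (h4.mul_left (X 1 1))).add
        (h2.mul_right (Y 1 0))).sub (h5.mul_left (X 1 0)) using 1
      ring
    · convert (((h5.mul_left (X 0 0)).add (h1.mul_right (ε * Y 1 0))).add
        (h2.mul_right (Y 1 1))).sub (h4.mul_left (ε * X 1 0)) using 1
      ring
  inv_mem' := by
    rintro X ⟨h1, h2, h3⟩
    simp only [Set.mem_ofPred_eq, Matrix.coe_units_inv, Matrix.inv_def, Matrix.adjugate_fin_two,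
      Matrix.smul_apply, smul_eq_mul, Matrix.of_apply, Matrix.cons_val', Matrix.cons_val_zero,
      Matrix.cons_val_one, Matrix.cons_val_fin_one]
    refine ⟨?_, ?_, (h3.neg_right).mul_left _⟩
    · convert h1.neg_right.mul_left (Ring.inverse (Matrix.det X.val)) using 1
      ring
    · convert h2.neg_right.mul_left (Ring.inverse (Matrix.det X.val)) using 1
      ring

variable {ε d d' : R}

lemma mem_congrSubgroup {X : GL (Fin 2) R} : X ∈ congrSubgroup ε d d' ↔
    d ∣ X 0 0 - X 1 1 ∧ d ∣ X 0 1 - ε * X 1 0 ∧ d' ∣ X 1 0 := Iff.rfl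

lemma congrSubgroup_mono {e e' : R} (h : d ∣ e) (h' : d' ∣ e') :
    congrSubgroup ε e e' ≤ congrSubgroup ε d d' :=
  fun _ hX => ⟨h.trans hX.1, h.trans hX.2.1, h'.trans hX.2.2⟩

lemma mem_congrSubgroup_of_congr (he : d' ∣ d) {X Y : GL (Fin 2) R}
    (hX : X ∈ congrSubgroup ε d d') (hY : ∀ i j, d ∣ Y i j - X i j) :
    Y ∈ congrSubgroup ε d d' := by
  refine ⟨?_, ?_, ?_⟩
  · convert (hX.1.add (hY 0 0)).sub (hY 1 1) using 1
    ring
  · convert (hX.2.1.add (hY 0 1)).sub ((hY 1 0).mul_left ε) using 1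
    ring
  · convert hX.2.2.add (he.trans (hY 1 0)) using 1
    ring

/-- Conjugation by `congrSubgroup ε d 1` preserves `congrSubgroup ε (e * d) e`. -/
lemma conj_mem_congrSubgroup {e : R} {x h : GL (Fin 2) R} (hx : x ∈ congrSubgroup ε d 1)
    (hh : h ∈ congrSubgroup ε (e * d) e) : x * h * x⁻¹ ∈ congrSubgroup ε (e * d) e := by
  have key : ∀ i j, e * d ∣ (x.val * h.val - h.val * x.val) i j := by
    obtain ⟨⟨α, hα⟩, ⟨β, hβ⟩, -⟩ := hx
    obtain ⟨⟨γ, hγ⟩, ⟨δ, hδ⟩, b, hb⟩ := hh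
    rw [sub_eq_iff_eq_add] at hα hβ hγ hδ
    intro i j
    fin_cases i <;> fin_cases j <;>
      simp only [Fin.zero_eta, Fin.mk_one, Fin.isValue, Matrix.sub_apply, Matrix.mul_apply,
        Fin.sum_univ_two, hα, hβ, hγ, hδ, hb]
    · exact ⟨β * b - δ * x 1 0, by ring⟩
    · exact ⟨(ε * b + d * δ) * α - x 0 1 * γ, by rw [hβ]; ring⟩
    · exact ⟨x 1 0 * γ - b * α, by ring⟩
    · exact ⟨δ * x 1 0 - β * b, by ring⟩
  refine mem_congrSubgroup_of_congr (Dvd.intro _ rfl) hh fun i j => ?_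
  have h1 : (x * h * x⁻¹).val - h.val = (x.val * h.val - h.val * x.val) * x⁻¹.val := by
    rw [sub_mul, mul_assoc h.val, Units.mul_inv, mul_one, Units.val_mul, Units.val_mul]
  have h2 := congr($h1 i j)
  rw [Matrix.mul_apply, Matrix.sub_apply] at h2
  rw [h2]
  exact Finset.dvd_sum fun k _ => (key i k).mul_right _

/-- An element of `congrSubgroup ε d 1` which is not scalar modulo `π` is conjugated into
`congrSubgroup ε d 1` by its own elements only. -/
lemma mem_congrSubgroup_of_conj_mem {π : R} (hπ : ¬ IsUnit π) (hunit : ∀ z, ¬ π ∣ z → IsUnit z)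
    (h2 : IsUnit (2 : R)) (hε : IsUnit ε) (hd : π ∣ d) {h x : GL (Fin 2) R}
    (hh : h ∈ congrSubgroup ε d 1) (hhπ : ¬ π ∣ h 1 0) (hx : x ∈ congrSubgroup ε π 1)
    (hxh : x * h * x⁻¹ ∈ congrSubgroup ε d 1) : x ∈ congrSubgroup ε d 1 := by
  obtain ⟨k, hk⟩ : ∃ k, k = x * h * x⁻¹ := ⟨_, rfl⟩
  rw [← hk] at hxh
  have htr : k 0 0 + k 1 1 = h 0 0 + h 1 1 := by
    rw [← Matrix.trace_fin_two, ← Matrix.trace_fin_two, hk]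
    exact Matrix.trace_units_conj x h.val
  have hmul : ∀ i j, x i 0 * h 0 j + x i 1 * h 1 j = k i 0 * x 0 j + k i 1 * x 1 j := by
    intro i j
    have h1 : x * h = k * x := by rw [hk, inv_mul_cancel_right]
    have h3 := congr(($h1).val i j)
    simpa only [Units.val_mul, Matrix.mul_apply, Fin.sum_univ_two] using h3
  have e00 := hmul 0 0
  have e01 := hmul 0 1
  have e10 := hmul 1 0
  have e11 := hmul 1 1
  obtain ⟨⟨γ, hγ⟩, ⟨δ, hδ⟩, -⟩ := hh
  obtain ⟨⟨γ', hγ'⟩, ⟨δ', hδ'⟩, -⟩ := hxh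
  obtain ⟨η, hη⟩ : d ∣ h 1 1 - k 1 1 := by
    rw [← h2.dvd_mul_left]
    exact ⟨γ' - γ, by linear_combination hγ' - hγ - htr⟩
  have hs : d ∣ (h 1 0 + k 1 0) * (x 0 1 - ε * x 1 0) :=
    ⟨η * (x 0 0 + x 1 1) + δ * x 1 0 + δ' * x 1 0, by
      linear_combination e00 - e11 + x 0 0 * htr + (x 0 0 + x 1 1) * hη + x 1 0 * hδ +
        x 1 0 * hδ'⟩
  have hr : d ∣ (h 1 0 + k 1 0) * (x 0 0 - x 1 1) := by
    rw [← hε.dvd_mul_left]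
    exact ⟨(η + γ) * (x 0 1 + ε * x 1 0) - δ * x 0 0 + δ' * x 1 1, by
      linear_combination e01 - ε * e10 + x 0 1 * htr + (x 0 1 + ε * x 1 0) * (hη + hγ) -
        x 0 0 * hδ + x 1 1 * hδ'⟩
  by_cases hc : π ∣ h 1 0 + k 1 0
  · refine absurd (isUnit_of_dvd_unit ?_ (Matrix.isUnits_det_units x)) hπ
    have hh' := hunit _ hhπ
    obtain ⟨e, rfl⟩ := hd
    obtain ⟨c, hc⟩ := hc
    obtain ⟨⟨α, hα⟩, ⟨β, hβ⟩, -⟩ := hx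
    have h00 : π ∣ x 0 0 := by
      rw [← h2.dvd_mul_left, ← hh'.dvd_mul_left]
      exact ⟨c * x 0 0 - e * (γ + η) * x 1 0 + h 1 0 * α, by
        linear_combination e10 + x 0 0 * hc - x 1 0 * (hγ + hη) + h 1 0 * hα⟩
    have h01 : π ∣ x 0 1 := by
      rw [← h2.dvd_mul_left, ← hh'.dvd_mul_left]
      exact ⟨c * ε * x 1 0 + e * η * x 0 0 + e * δ' * x 1 0 + h 1 0 * β, by
        linear_combination e00 + x 0 0 * htr + x 0 0 * hη + x 1 0 * hδ' + ε * x 1 0 * hc +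
          h 1 0 * hβ⟩
    rw [Matrix.det_fin_two]
    exact (h00.mul_right _).sub (h01.mul_right _)
  · rw [(hunit _ hc).dvd_mul_left] at hs hr
    exact ⟨hr, hs, one_dvd _⟩

lemma isUnit_det_iff {π : R} (hunit : ∀ z, IsUnit z ↔ ¬ π ∣ z)
    (haniso : ∀ a b, π ∣ a ^ 2 - ε * b ^ 2 → π ∣ a ∧ π ∣ b) (hd : π ∣ d)
    {M : Matrix (Fin 2) (Fin 2) R} (h1 : d ∣ M 0 0 - M 1 1) (h2 : d ∣ M 0 1 - ε * M 1 0) :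
    IsUnit M.det ↔ ¬ (π ∣ M 1 1 ∧ π ∣ M 1 0) := by
  have h3 : π ∣ M.det - (M 1 1 ^ 2 - ε * M 1 0 ^ 2) := by
    rw [Matrix.det_fin_two]
    convert hd.trans ((h1.mul_right (M 1 1)).sub (h2.mul_right (M 1 0))) using 1
    ring
  rw [hunit, dvd_iff_dvd_of_dvd_sub h3]
  refine not_congr ⟨fun h => haniso _ _ h, fun h => ?_⟩
  exact (h.1.pow two_ne_zero).sub ((h.2.pow two_ne_zero).mul_left _)

lemma card_congrSubgroup [Finite R] {π : R} (hunit : ∀ z, IsUnit z ↔ ¬ π ∣ z)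
    (haniso : ∀ a b, π ∣ a ^ 2 - ε * b ^ 2 → π ∣ a ∧ π ∣ b) (hd : π ∣ d) :
    Nat.card (congrSubgroup ε d d') =
      {q : R × R | ¬ (π ∣ q.1 ∧ π ∣ q.2) ∧ d' ∣ q.2}.ncard * {x : R | d ∣ x}.ncard ^ 2 := by
  rw [sq, ← Set.ncard_prod, ← Set.ncard_prod]
  refine Set.ncard_congr (s := (congrSubgroup ε d d' : Set (GL (Fin 2) R)))
    (fun X _ => ((X 1 1, X 1 0), (X 0 0 - X 1 1, X 0 1 - ε * X 1 0))) ?_ ?_ ?_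
  · rintro X ⟨h1, h2, h3⟩
    exact ⟨⟨(isUnit_det_iff hunit haniso hd h1 h2).1 (Matrix.isUnits_det_units X), h3⟩, h1, h2⟩
  · intro X Y _ _ h
    simp only [Prod.mk.injEq] at h
    obtain ⟨⟨h11, h10⟩, h00, h01⟩ := h
    rw [h11, sub_left_inj] at h00
    rw [h10, sub_left_inj] at h01
    ext i j
    fin_cases i <;> fin_cases j <;> assumption
  · rintro ⟨⟨a, b⟩, c, e⟩ ⟨⟨h1, h2⟩, h3, h4⟩
    have hdet : IsUnit (!![a + c, ε * b + e; b, a] : Matrix (Fin 2) (Fin 2) R).det :=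
      (isUnit_det_iff hunit haniso hd (by simpa using h3) (by simpa using h4)).2
        (by simpa using h1)
    refine ⟨Matrix.GeneralLinearGroup.mk'' _ hdet, ⟨?_, ?_, ?_⟩, ?_⟩ <;>
      simp [Matrix.GeneralLinearGroup.mk'', Matrix.nonsingInvUnit]
    · exact h3
    · exact h4
    · exact h2

lemma ncard_prod_compl_add [Finite R] (π : R) :
    {q : R × R | ¬ (π ∣ q.1 ∧ π ∣ q.2) ∧ 1 ∣ q.2}.ncard + {x : R | π ∣ x}.ncard ^ 2 =
      Nat.card R ^ 2 := by
  have h : {q : R × R | ¬ (π ∣ q.1 ∧ π ∣ q.2) ∧ 1 ∣ q.2} =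
      ({x : R | π ∣ x} ×ˢ {x : R | π ∣ x})ᶜ := by
    ext q
    simp
  rw [h, sq, sq, ← Set.ncard_prod, Set.ncard_compl_add_ncard, Nat.card_prod]

lemma ncard_compl_prod_add [Finite R] (π : R) :
    {q : R × R | ¬ (π ∣ q.1 ∧ π ∣ q.2) ∧ π ∣ q.2}.ncard + {x : R | π ∣ x}.ncard ^ 2 =
      Nat.card R * {x : R | π ∣ x}.ncard := by
  have h : {q : R × R | ¬ (π ∣ q.1 ∧ π ∣ q.2) ∧ π ∣ q.2} =
      {x : R | π ∣ x}ᶜ ×ˢ {x : R | π ∣ x} := by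
    ext q
    simp +contextual
  rw [h, sq, Set.ncard_prod, ← add_mul, Set.ncard_compl_add_ncard]

end CongruenceSubgroup

section PrimePowerModulus

variable {p l ε k : ℕ}

lemma aChar_one_eq_stdAddChar (N : ℕ) [NeZero N] (x : ZMod N) :
    aChar N 1 x = ZMod.stdAddChar x := by
  conv_rhs => rw [← ZMod.natCast_zmod_val x]
  have h := ZMod.stdAddChar_coe (N := N) x.val
  rw [Int.cast_natCast] at h
  rw [h, aChar]
  simp

lemma isUnit_two_of_odd (hp' : Odd p) : IsUnit (2 : ZMod (p ^ l)) := by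
  have h := (ZMod.isUnit_iff_coprime 2 (p ^ l)).2 (hp'.pow.coprime_two_left)
  exact_mod_cast h

lemma Kset_subset_congrSubgroup {m : ℕ} {X : GL (Fin 2) (ZMod (p ^ l))}
    (hX : X ∈ Kset p l (m + 1)) :
    X ∈ congrSubgroup (ε : ZMod (p ^ l)) ((p : ZMod (p ^ l)) ^ (m + 1)) p := by
  obtain ⟨B, hB⟩ := hX
  refine mem_congrSubgroup_of_congr (dvd_pow_self _ m.succ_ne_zero) (one_mem _) fun i j => ?_
  rw [hB]
  exact ⟨B i j, by simp⟩

lemma coe_congrSubgroup_eq_NsetOdd (m : ℕ) :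
    (congrSubgroup (ε : ZMod (p ^ l)) ((p : ZMod (p ^ l)) ^ (m + 1)) p :
      Set (GL (Fin 2) (ZMod (p ^ l)))) = NsetOdd p l ε m := by
  ext X
  constructor
  · rintro ⟨⟨c, hc⟩, ⟨e, he⟩, b, hb⟩
    refine ⟨X 0 0, b, e, -c, ?_⟩
    ext i j
    fin_cases i <;> fin_cases j <;> simp
    · linear_combination he + ε * hb
    · exact hb
    · linear_combination -hc
  · rintro ⟨a, b, c, d, hX⟩
    rw [SetLike.mem_coe, mem_congrSubgroup, hX]
    refine ⟨⟨-d, ?_⟩, ⟨c, ?_⟩, b, ?_⟩ <;> simp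
    ring

variable [hp : Fact p.Prime]

lemma isUnit_iff_not_prime_dvd (hl : l ≠ 0) (z : ZMod (p ^ l)) :
    IsUnit z ↔ ¬ (p : ZMod (p ^ l)) ∣ z := by
  constructor
  · intro hz hpz
    have := isUnit_of_dvd_unit hpz hz
    rw [ZMod.isUnit_iff_coprime, Nat.coprime_pow_right_iff (Nat.pos_of_ne_zero hl),
      Nat.coprime_self] at this
    exact hp.out.one_lt.ne' this
  · intro hz
    rw [← ZMod.natCast_zmod_val z] at hz ⊢
    rw [ZMod.isUnit_iff_coprime]
    refine (Nat.Coprime.pow_left l ?_).symm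
    rw [hp.out.coprime_iff_not_dvd]
    exact fun h => hz (Nat.cast_dvd_cast h)

lemma castHom_eq_zero_iff (hl : l ≠ 0) (z : ZMod (p ^ l)) :
    ZMod.castHom (dvd_pow_self p hl) (ZMod p) z = 0 ↔ (p : ZMod (p ^ l)) ∣ z := by
  constructor
  · intro h
    rw [← ZMod.natCast_zmod_val z] at h ⊢
    rw [map_natCast, ZMod.natCast_eq_zero_iff] at h
    exact Nat.cast_dvd_cast h
  · rintro ⟨w, rfl⟩
    rw [map_mul, map_natCast, ZMod.natCast_self, zero_mul]

lemma prime_dvd_of_dvd_sq_sub (hl : l ≠ 0) (hres : ¬ IsSquare (ε : ZMod p))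
    (a b : ZMod (p ^ l)) (h : (p : ZMod (p ^ l)) ∣ a ^ 2 - ε * b ^ 2) :
    (p : ZMod (p ^ l)) ∣ a ∧ (p : ZMod (p ^ l)) ∣ b := by
  simp only [← castHom_eq_zero_iff hl, map_sub, map_mul, map_pow, map_natCast] at h ⊢
  set x := ZMod.castHom (dvd_pow_self p hl) (ZMod p) a
  set y := ZMod.castHom (dvd_pow_self p hl) (ZMod p) b
  have hy : y = 0 := by
    by_contra hy
    refine hres ⟨x / y, ?_⟩
    field_simp
    linear_combination -h
  refine ⟨?_, hy⟩
  simpa [hy] using h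

lemma ncard_pow_dvd (hk : k ≤ l) :
    {x : ZMod (p ^ l) | (p : ZMod (p ^ l)) ^ k ∣ x}.ncard = p ^ (l - k) := by
  have h : {x : ZMod (p ^ l) | (p : ZMod (p ^ l)) ^ k ∣ x} =
      AddSubgroup.zmultiples ((p ^ k : ℕ) : ZMod (p ^ l)) := by
    ext x
    rw [SetLike.mem_coe, AddSubgroup.mem_zmultiples_iff]
    constructor
    · rintro ⟨y, rfl⟩
      exact ⟨y.val, by simp [mul_comm]⟩
    · rintro ⟨n, rfl⟩
      exact ⟨n, by simp [mul_comm]⟩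
  rw [h, ← Nat.card_coe_set_eq]
  change Nat.card (AddSubgroup.zmultiples ((p ^ k : ℕ) : ZMod (p ^ l))) = _
  rw [Nat.card_zmultiples, ZMod.addOrderOf_coe _ (pow_ne_zero l hp.out.ne_zero),
    Nat.gcd_eq_right (pow_dvd_pow p hk), Nat.pow_div hk hp.out.pos]

lemma isUnit_natCast_of_not_isSquare (hl : l ≠ 0) (hres : ¬ IsSquare (ε : ZMod p)) :
    IsUnit (ε : ZMod (p ^ l)) := by
  rw [isUnit_iff_not_prime_dvd hl, ← castHom_eq_zero_iff hl, map_natCast]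
  rintro h
  exact hres (h ▸ IsSquare.zero)

lemma coe_congrSubgroup_eq_TKS (hl : l ≠ 0) (hk : k ≠ 0) (hres : ¬ IsSquare (ε : ZMod p)) :
    (congrSubgroup (ε : ZMod (p ^ l)) ((p : ZMod (p ^ l)) ^ k) 1 : Set (GL (Fin 2) _)) =
      TKS p l ε k := by
  have hunit := isUnit_iff_not_prime_dvd (p := p) hl
  have haniso := prime_dvd_of_dvd_sq_sub hl hres
  have hd : (p : ZMod (p ^ l)) ∣ p ^ k := dvd_pow_self _ hk
  ext X
  constructor
  · rintro ⟨h1, h2, -⟩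
    have hX := (isUnit_det_iff hunit haniso hd h1 h2).1 (Matrix.isUnits_det_units X)
    let Z : Matrix (Fin 2) (Fin 2) (ZMod (p ^ l)) := !![X 1 1, ε * X 1 0; X 1 0, X 1 1]
    have hdet : IsUnit Z.det :=
      (isUnit_det_iff hunit haniso hd (by simp [Z]) (by simp [Z])).2 (by simpa [Z] using hX)
    obtain ⟨c, hc⟩ := h1
    obtain ⟨e, he⟩ := h2
    let Z' : GL (Fin 2) (ZMod (p ^ l)) := Matrix.GeneralLinearGroup.mk'' Z hdet
    refine ⟨X * Z'⁻¹, ⟨!![c, e; 0, 0] * Z'⁻¹.val, ?_⟩, Z', ⟨X 1 1, X 1 0, rfl⟩,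
      (inv_mul_cancel_right X Z').symm⟩
    have hXZ : X.val = Z'.val + (p : ZMod (p ^ l)) ^ k • !![c, e; 0, 0] := by
      ext i j
      fin_cases i <;> fin_cases j <;>
        simp [Z', Z, Matrix.GeneralLinearGroup.mk'', Matrix.nonsingInvUnit]
      · linear_combination hc
      · linear_combination he
    rw [Units.val_mul, hXZ, add_mul, Units.mul_inv, Matrix.smul_mul]
  · rintro ⟨Y, ⟨B, hB⟩, Z, ⟨a, b, hZ⟩, rfl⟩
    refine mem_congrSubgroup_of_congr (X := Z) (one_dvd _) ?_ fun i j => ?_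
    · rw [mem_congrSubgroup, hZ]
      simp
    · rw [Units.val_mul, hB]
      exact ⟨(B * Z.val) i j, by simp [add_mul]⟩

end PrimePowerModulus

lemma indC_eq_inducedFun {N : ℕ} [NeZero N] {H T : Subgroup (GL (Fin 2) (ZMod N))} [Fintype T]
    (hHT : H ≤ T) (φ : GL (Fin 2) (ZMod N) → ℂ) (t : T) :
    indC N H T φ t = inducedFun (H.subgroupOf T) (fun x => φ x) t := by
  classical
  have hcard : Nat.card (H : Set (GL (Fin 2) (ZMod N))) = Nat.card (H.subgroupOf T) :=
    (Nat.card_congr (Subgroup.subgroupOfEquivOfLe hHT).toEquiv).symm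
  rw [indC, inducedFun, hcard]
  congr 1
  simp only [Set.indicator_apply, SetLike.mem_coe]
  rw [← Finset.sum_filter, Finset.sum_subtype _ (p := (· ∈ T)) (by simp)]
  rfl

section UpperRight

open Matrix.GeneralLinearGroup

variable {p l : ℕ}

lemma upperRightHom_mem_Kset {k : ℕ} {y : ZMod (p ^ l)} (hy : (p : ZMod (p ^ l)) ^ k ∣ y) :
    upperRightHom y ∈ Kset p l k := by
  obtain ⟨z, rfl⟩ := hy
  refine ⟨!![0, z; 0, 0], ?_⟩
  ext i j
  fin_cases i <;> fin_cases j <;> simp [upperRightHom]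

lemma phiA_upperRightHom [NeZero (p ^ l)] (a b c y : ZMod (p ^ l)) :
    phiA p l !![a, b; 1, c] (upperRightHom y) = ZMod.stdAddChar y := by
  rw [phiA, aChar_one_eq_stdAddChar]
  congr 1
  simp [upperRightHom, Matrix.trace_fin_two, Matrix.one_fin_two]

lemma upperRightHom_mem_congrSubgroup {R : Type} [CommRing R] {ε d y : R} (hy : d ∣ y) :
    upperRightHom y ∈ congrSubgroup ε d 1 := by
  rw [mem_congrSubgroup]
  simpa [upperRightHom] using hy

/-- The diagonal matrix with entries `v` and `1`. -/
def diagOne {R : Type} [CommRing R] (v : Rˣ) : GL (Fin 2) R :=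
  ⟨!![v.val, 0; 0, 1], !![v⁻¹.val, 0; 0, 1], by simp [Matrix.one_fin_two],
    by simp [Matrix.one_fin_two]⟩

lemma diagOne_mul_upperRightHom {R : Type} [CommRing R] (v : Rˣ) (y : R) :
    diagOne v * upperRightHom y * (diagOne v)⁻¹ =
      upperRightHom ((v - 1) * y) * upperRightHom y := by
  rw [mul_inv_eq_iff_eq_mul, ← AddChar.map_add_eq_mul]
  ext i j
  fin_cases i <;> fin_cases j <;> simp [upperRightHom, diagOne]
  ring

end UpperRight

/-- Lemma 3.4: for `l = 2m+1` odd, the class function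
`ψ_φ = (1/p)·Ind_{N_{m+1}}^{T}(φ|_{N_{m+1}}) − Ind_{L}^{T} φ` is the character of an
irreducible finite-dimensional complex representation of `T = K_m·S`; moreover
`ψ_φ(I) = p` and `ψ_φ = p·φ_{A₀}` on `K_{m+1}`. -/
theorem lemma_3_4 (p m : ℕ) [Fact p.Prime] (hp : Odd p) (hm : 1 ≤ m)
    (ε : ℕ) (hε : ε < p ^ m) (hres : ¬ IsSquare (ε : ZMod p))
    (φ : GL (Fin 2) (ZMod (p ^ (2 * m + 1))) → ℂ)
    (hφmul : ∀ X Y : GL (Fin 2) (ZMod (p ^ (2 * m + 1))),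
      X ∈ TKS p (2 * m + 1) ε (m + 1) → Y ∈ TKS p (2 * m + 1) ε (m + 1) →
        φ (X * Y) = φ X * φ Y)
    (hφne : ∀ X ∈ TKS p (2 * m + 1) ε (m + 1), φ X ≠ 0)
    (hφK : ∀ X ∈ Kset p (2 * m + 1) (m + 1),
      φ X = phiA p (2 * m + 1)
        !![(0 : ZMod (p ^ (2 * m + 1))), (ε : ZMod (p ^ (2 * m + 1))); 1, 0] X)
    (hφstab : ∀ t ∈ TKS p (2 * m + 1) ε m, ∀ X ∈ NsetOdd p (2 * m + 1) ε m,
      φ (t * X * t⁻¹) = φ X) :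
    (∃ T' : Subgroup (GL (Fin 2) (ZMod (p ^ (2 * m + 1)))),
      (T' : Set (GL (Fin 2) (ZMod (p ^ (2 * m + 1))))) = TKS p (2 * m + 1) ε m ∧
      ∃ (d : ℕ) (_ : 0 < d) (ρ : Representation ℂ T' (Fin d → ℂ)),
        (∀ W : Submodule ℂ (Fin d → ℂ), (∀ g : T', ∀ v ∈ W, ρ g v ∈ W) → W = ⊥ ∨ W = ⊤) ∧
        (∀ t : T', LinearMap.trace ℂ (Fin d → ℂ) (ρ t) =
          (1 / (p : ℂ)) *
              indC (p ^ (2 * m + 1)) (NsetOdd p (2 * m + 1) ε m) (TKS p (2 * m + 1) ε m) φ t -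
            indC (p ^ (2 * m + 1)) (TKS p (2 * m + 1) ε (m + 1)) (TKS p (2 * m + 1) ε m) φ t)) ∧
    ((1 / (p : ℂ)) *
          indC (p ^ (2 * m + 1)) (NsetOdd p (2 * m + 1) ε m) (TKS p (2 * m + 1) ε m) φ 1 -
        indC (p ^ (2 * m + 1)) (TKS p (2 * m + 1) ε (m + 1)) (TKS p (2 * m + 1) ε m) φ 1 = p) ∧
    (∀ X ∈ Kset p (2 * m + 1) (m + 1),
      (1 / (p : ℂ)) *
            indC (p ^ (2 * m + 1)) (NsetOdd p (2 * m + 1) ε m) (TKS p (2 * m + 1) ε m) φ X -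
          indC (p ^ (2 * m + 1)) (TKS p (2 * m + 1) ε (m + 1)) (TKS p (2 * m + 1) ε m) φ X =
        p * phiA p (2 * m + 1)
          !![(0 : ZMod (p ^ (2 * m + 1))), (ε : ZMod (p ^ (2 * m + 1))); 1, 0] X) := by
  classical
  have hp0 : p.Prime := Fact.out
  have hl : 2 * m + 1 ≠ 0 := by omega
  have hm0 : m ≠ 0 := by omega
  have hunit := isUnit_iff_not_prime_dvd (p := p) hl
  have haniso := prime_dvd_of_dvd_sq_sub hl hres
  set π : ZMod (p ^ (2 * m + 1)) := (p : ZMod (p ^ (2 * m + 1))) with hπ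
  have hπm : π ∣ π ^ m := dvd_pow_self _ hm0
  have hπm1 : π ∣ π ^ (m + 1) := dvd_pow_self _ m.succ_ne_zero
  have hmm1 : π ^ m ∣ π ^ (m + 1) := pow_dvd_pow _ m.le_succ
  have hTset := coe_congrSubgroup_eq_TKS (k := m) hl hm0 hres
  have hLset := coe_congrSubgroup_eq_TKS (k := m + 1) hl m.succ_ne_zero hres
  have hNset := coe_congrSubgroup_eq_NsetOdd (p := p) (l := 2 * m + 1) (ε := ε) m
  set T := congrSubgroup (ε : ZMod (p ^ (2 * m + 1))) (π ^ m) 1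
  set L := congrSubgroup (ε : ZMod (p ^ (2 * m + 1))) (π ^ (m + 1)) 1
  set N := congrSubgroup (ε : ZMod (p ^ (2 * m + 1))) (π ^ (m + 1)) π
  rw [← hLset] at hφmul hφne
  rw [← hTset, ← hNset] at hφstab
  rw [← hTset, ← hLset, ← hNset]
  have hNL : N ≤ L := congrSubgroup_mono dvd_rfl (one_dvd _)
  have hLT : L ≤ T := congrSubgroup_mono hmm1 dvd_rfl
  have hNT := hNL.trans hLT
  have hK : ∀ X ∈ Kset p (2 * m + 1) (m + 1), X ∈ N := fun X hX => Kset_subset_congrSubgroup hX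
  have hφone : φ 1 = 1 := by
    have h := hφmul 1 1 (one_mem L) (one_mem L)
    rw [one_mul] at h
    exact (mul_eq_left₀ (hφne 1 (one_mem L))).1 h.symm
  have hcard := card_congrSubgroup (d' := 1) hunit haniso hπm
  have hcardL := card_congrSubgroup (d' := 1) hunit haniso hπm1
  have hcardN := card_congrSubgroup (d' := π) hunit haniso hπm1
  have hU := ncard_prod_compl_add π
  have hU' := ncard_compl_prod_add π
  have hπcard := ncard_pow_dvd (p := p) (l := 2 * m + 1) (k := 1) (by omega)
  rw [pow_one, show 2 * m + 1 - 1 = 2 * m by omega] at hπcard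
  rw [ncard_pow_dvd (by omega), show 2 * m + 1 - m = m + 1 by omega] at hcard
  rw [ncard_pow_dvd (by omega), show 2 * m + 1 - (m + 1) = m by omega] at hcardL hcardN
  rw [← hπ] at hπcard
  rw [Nat.card_zmod, hπcard] at hU hU'
  have hTL : Nat.card T = p ^ 2 * Nat.card L := by
    rw [hcard, hcardL]
    ring
  have hLN : Nat.card L = (p + 1) * Nat.card N := by
    rw [hcardL, hcardN, ← mul_assoc]
    congr 1
    zify at hU hU' ⊢
    linear_combination hU - (p + 1) * hU'
  have hind : ∀ t : T, (1 / (p : ℂ)) * indC (p ^ (2 * m + 1)) N T φ t -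
      indC (p ^ (2 * m + 1)) L T φ t =
        frobeniusDiff (N.subgroupOf T) (L.subgroupOf T) (fun x => φ x) p t := by
    intro t
    rw [frobeniusDiff, indC_eq_inducedFun hNT, indC_eq_inducedFun hLT]
  have hnorm : (N.subgroupOf T).Normal := by
    refine ⟨fun n hn t => ?_⟩
    rw [Subgroup.mem_subgroupOf] at hn ⊢
    have h := conj_mem_congrSubgroup t.2
      (by rwa [← pow_succ'] : n.1 ∈ congrSubgroup _ (π * π ^ m) π)
    rwa [← pow_succ'] at h
  have hNL' : N.subgroupOf T ≤ L.subgroupOf T := fun x hx => hNL hx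
  have hstab : ∀ t : T, ∀ x ∈ N.subgroupOf T, φ (t * x * t⁻¹ : T) = φ x :=
    fun t x hx => hφstab t t.2 x hx
  have hL' : Nat.card T = p ^ 2 * Nat.card (L.subgroupOf T) := by
    rw [Nat.card_congr (Subgroup.subgroupOfEquivOfLe hLT).toEquiv, hTL]
  have hN' : Nat.card (L.subgroupOf T) = (p + 1) * Nat.card (N.subgroupOf T) := by
    rw [Nat.card_congr (Subgroup.subgroupOfEquivOfLe hLT).toEquiv,
      Nat.card_congr (Subgroup.subgroupOfEquivOfLe hNT).toEquiv, hLN]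
  have hval : ∀ X ∈ N, (1 / (p : ℂ)) * indC (p ^ (2 * m + 1)) N T φ X -
      indC (p ^ (2 * m + 1)) L T φ X = p * φ X := fun X hX => by
    rw [hind ⟨X, hNT hX⟩]
    exact frobeniusDiff_of_mem hNL' hstab hp0.ne_zero hL' hN' (g := ⟨X, hNT hX⟩) hX
  refine ⟨⟨T, rfl, ?_⟩, ?_, fun X hX => ?_⟩
  · simp only [hind]
    have hφu : ∀ y : ZMod (p ^ (2 * m + 1)), π ^ (m + 1) ∣ y →
        Matrix.GeneralLinearGroup.upperRightHom y ∈ N ∧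
          φ (Matrix.GeneralLinearGroup.upperRightHom y) = ZMod.stdAddChar y := fun y hy => by
      have h := upperRightHom_mem_Kset hy
      exact ⟨hK _ h, (hφK _ h).trans (phiA_upperRightHom _ _ _ _)⟩
    let f : Multiplicative (ZMod (p ^ (2 * m + 1))) →* Multiplicative (ZMod (p ^ (2 * m + 1))) :=
      AddMonoidHom.toMultiplicative (AddMonoidHom.mulLeft (π ^ m))
    let u : Multiplicative (ZMod (p ^ (2 * m + 1))) →* T :=
      (Matrix.GeneralLinearGroup.upperRightHom.toMonoidHom.comp f).codRestrict T fun b =>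
        upperRightHom_mem_congrSubgroup (Dvd.intro _ rfl)
    let B₀ : Subgroup (Multiplicative (ZMod (p ^ (2 * m + 1)))) :=
      AddSubgroup.toSubgroup (Ideal.span {π}).toAddSubgroup
    have hB₀ : ∀ b, b ∈ B₀ ↔ π ∣ b.toAdd :=
      fun b => Ideal.mem_span_singleton (x := b.toAdd) (y := π)
    refine exists_irreducible_frobeniusDiff hNL' (fun x hx y hy => hφmul x y hx hy) hφone hstab ?_
      hp0.ne_zero hL' hN' u ((ZMod.stdAddChar.toMonoidHom).comp f)
      B₀ ?_ ?_ ?_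
    · intro h hh hhN x hx
      refine mem_congrSubgroup_of_conj_mem (fun h => (hunit π).1 h dvd_rfl)
        (fun z => (hunit z).2) (isUnit_two_of_odd hp) (isUnit_natCast_of_not_isSquare hl hres)
        hπm1 hh ?_ (congrSubgroup_mono hπm dvd_rfl x.2) hx
      exact fun h10 => hhN ⟨hh.1, hh.2.1, h10⟩
    · rw [Nat.card_congr (Multiplicative.toAdd.subtypeEquiv hB₀ :
        B₀ ≃ {x : ZMod (p ^ (2 * m + 1)) | π ∣ x}), Nat.card_coe_set_eq, hπcard,
        Nat.card_congr Multiplicative.toAdd, Nat.card_zmod, pow_succ']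
    · intro b hb
      refine hφu (π ^ m * b.toAdd) ?_
      rw [pow_succ π]
      exact mul_dvd_mul_left _ ((hB₀ b).1 hb)
    · intro b hb
      have hbu : IsUnit b.toAdd := (hunit _).2 fun h => hb ((hB₀ b).2 h)
      obtain ⟨v, hv⟩ : IsUnit (1 + π ^ m) := by
        rw [hunit, dvd_add_left hπm]
        exact fun h => (hunit π).1 (isUnit_of_dvd_one h) dvd_rfl
      have hv' : v - 1 = π ^ m := by rw [hv, add_sub_cancel_left]
      have hvT : diagOne v ∈ T := by
        rw [mem_congrSubgroup]
        simp [diagOne, hv']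
      have hcN := hφu (π ^ m * (π ^ m * b.toAdd)) (by
        rw [← mul_assoc, ← pow_add]
        exact (pow_dvd_pow _ (by omega)).mul_right _)
      refine ⟨⟨_, hvT⟩, ⟨_, hNT hcN.1⟩, hcN.1, ?_, ?_⟩
      · ext1
        have h := diagOne_mul_upperRightHom v (π ^ m * b.toAdd)
        rwa [hv'] at h
      · change φ (Matrix.GeneralLinearGroup.upperRightHom (π ^ m * (π ^ m * b.toAdd))) ≠ 1
        rw [hcN.2, Ne, ZMod.injective_stdAddChar.eq_iff' (AddChar.map_zero_eq_one _),
          ← mul_assoc, ← pow_add, hbu.mul_left_eq_zero, hπ, ← Nat.cast_pow,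
          ZMod.natCast_eq_zero_iff, Nat.pow_dvd_pow_iff_le_right hp0.one_lt]
        omega
  · rw [hval 1 (one_mem N), hφone, mul_one]
  · rw [hval X (hK X hX), hφK X hX]
end
end

section
/- If φ and φ′ are two group homomorphisms L → ℂ^× with φ|_{K_{m+1}} = φ′|_{K_{m+1}} = φ_{A₀}, whose restrictions to N_{m+1} are stable under conjugation by T, and if ψ_φ = ψ_{φ′} (where ψ_φ := (1/p)·Ind_{N_{m+1}}^{T}(φ|_{N_{m+1}}) − Ind_{L}^{T} φ), then φ = φ′. (Distinctness claim of Lemma 3.4.) -/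
noncomputable section
open Matrix Complex

section Divisibility

variable {R : Type*} [CommRing R]

/-- If `p` divides `h - a` for a scalar matrix `a` and `y g = h y` with `y` invertible,
then `p` divides the lower-left entry of `g`. -/
lemma dvd_entry_of_conj_scalar {p : R} (g y : GL (Fin 2) R) (a : R)
    (M : Matrix (Fin 2) (Fin 2) R)
    (h : (y * g * y⁻¹).val = a • (1 : Matrix (Fin 2) (Fin 2) R) + p • M) :
    p ∣ g.val 1 0 := by
  have hg : g = y⁻¹ * (y * g * y⁻¹) * y := by group
  have hval : g.val = a • (1 : Matrix (Fin 2) (Fin 2) R) + p • (y⁻¹.val * M * y.val) := by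
    rw [hg, Units.val_mul, Units.val_mul, h, mul_add, add_mul]
    simp
  rw [hval]
  exact ⟨(y⁻¹.val * M * y.val) 1 0, by
    simp only [Matrix.add_apply, Matrix.smul_apply, smul_eq_mul]; simp⟩

/-- A matrix conjugating one matrix that commutes with `[[0, ε], [1, 0]]` modulo `p ^ (m + 1)`
to another, and that commutes with `[[0, ε], [1, 0]]` modulo `p ^ m`, does so modulo
`p ^ (m + 1)`, as soon as the first matrix is not scalar modulo `p`. -/
lemma dvd_of_conj_entries {p ε : R} {m : ℕ} (hm : 1 ≤ m)
    (hunit : ∀ x : R, ¬ p ∣ x → IsUnit x) (hpu : ¬ IsUnit p) (h2 : IsUnit (2 : R))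
    (hε : IsUnit ε) (g h y : Matrix (Fin 2) (Fin 2) R) (hy : IsUnit y.det)
    (hb : IsUnit (g 1 0)) (e : y * g = h * y)
    (hg1 : p ^ (m + 1) ∣ g 0 0 - g 1 1) (hg2 : p ^ (m + 1) ∣ g 0 1 - ε * g 1 0)
    (hh1 : p ^ (m + 1) ∣ h 0 0 - h 1 1) (hh2 : p ^ (m + 1) ∣ h 0 1 - ε * h 1 0)
    (hy1 : p ^ m ∣ y 0 0 - y 1 1) (hy2 : p ^ m ∣ y 0 1 - ε * y 1 0) :
    p ^ (m + 1) ∣ y 0 0 - y 1 1 ∧ p ^ (m + 1) ∣ y 0 1 - ε * y 1 0 := by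
  have e00 := congrFun (congrFun e 0) 0
  have e01 := congrFun (congrFun e 0) 1
  have e10 := congrFun (congrFun e 1) 0
  have e11 := congrFun (congrFun e 1) 1
  simp only [Matrix.mul_apply, Fin.sum_univ_two] at e00 e01 e10 e11
  rw [Matrix.det_fin_two] at hy
  generalize y 0 0 = y0 at *
  generalize y 0 1 = y1 at *
  generalize y 1 0 = s at *
  generalize y 1 1 = t at *
  generalize g 0 0 = g0 at *
  generalize g 0 1 = g1 at *
  generalize g 1 0 = b at *
  generalize g 1 1 = a at *
  generalize h 0 0 = h0 at *
  generalize h 0 1 = h1 at *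
  generalize h 1 0 = d at *
  generalize h 1 1 = c at *
  obtain ⟨α, hg1⟩ := hg1
  obtain ⟨β, hg2⟩ := hg2
  obtain ⟨γ, hh1⟩ := hh1
  obtain ⟨δ, hh2⟩ := hh2
  obtain ⟨u, hy1⟩ := hy1
  obtain ⟨v, hy2⟩ := hy2
  obtain rfl : g0 = a + p ^ (m + 1) * α := by linear_combination hg1
  obtain rfl : g1 = ε * b + p ^ (m + 1) * β := by linear_combination hg2
  obtain rfl : h0 = c + p ^ (m + 1) * γ := by linear_combination hh1
  obtain rfl : h1 = ε * d + p ^ (m + 1) * δ := by linear_combination hh2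
  obtain rfl : y0 = t + p ^ m * u := by linear_combination hy1
  obtain rfl : y1 = ε * s + p ^ m * v := by linear_combination hy2
  obtain ⟨k, rfl⟩ : ∃ k, m = k + 1 := ⟨m - 1, by omega⟩
  have hD : IsUnit (t ^ 2 - ε * s ^ 2) := by
    apply hunit
    rintro ⟨z, hz⟩
    refine hpu (isUnit_of_dvd_unit ⟨z + p ^ k * (u * t - v * s), ?_⟩ hy)
    linear_combination hz
  have hbd : p ∣ b - d := by
    rw [← hD.dvd_mul_left]
    refine ⟨-(t * s * p ^ (k + 1) * α) + t * d * p ^ k * u - s * d * p ^ k * v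
      + s ^ 2 * p ^ (k + 1) * β, ?_⟩
    linear_combination t * e10 - s * e11
  have hac : p ∣ a - c := by
    rw [← hD.dvd_mul_left]
    refine ⟨-(t * s * p ^ (k + 1) * β) + t * d * p ^ k * v - ε * s * d * p ^ k * u
      + ε * s ^ 2 * p ^ (k + 1) * α, ?_⟩
    linear_combination t * e11 - ε * s * e10
  obtain ⟨x, hx⟩ := hbd
  obtain ⟨z, hz⟩ := hac
  constructor
  · rw [← ((h2.mul hb).mul hε).dvd_mul_left]
    refine ⟨ε * u * x - v * z + γ * ε * s + γ * p ^ (k + 1) * v + δ * t - t * β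
      - p ^ (k + 1) * u * β + ε * s * α, ?_⟩
    linear_combination e01 - ε * e10 + ε * p ^ (k + 1) * u * hx - p ^ (k + 1) * v * hz
  · rw [← (h2.mul hb).dvd_mul_left]
    refine ⟨v * x - u * z + γ * t + γ * p ^ (k + 1) * u + δ * s + s * β - t * α
      - p ^ (k + 1) * u * α, ?_⟩
    linear_combination e00 - e11 + p ^ (k + 1) * v * hx - p ^ (k + 1) * u * hz

end Divisibility

section PrimePower

variable {p : ℕ} [Fact p.Prime]

lemma not_isUnit_natCast_prime {l : ℕ} (hl : l ≠ 0) : ¬ IsUnit (p : ZMod (p ^ l)) := by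
  rw [ZMod.isUnit_iff_coprime, Nat.coprime_pow_right_iff (Nat.pos_of_ne_zero hl),
    Nat.coprime_self]
  exact (Fact.out : p.Prime).ne_one

lemma isUnit_natCast_of_not_dvd {l n : ℕ} (h : ¬ p ∣ n) : IsUnit (n : ZMod (p ^ l)) := by
  rw [ZMod.isUnit_iff_coprime]
  exact (((Fact.out : p.Prime).coprime_iff_not_dvd.2 h).symm).pow_right l

lemma isUnit_of_not_dvd {l : ℕ} (x : ZMod (p ^ l)) (h : ¬ (p : ZMod (p ^ l)) ∣ x) :
    IsUnit x := by
  rw [← ZMod.natCast_zmod_val x] at h ⊢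
  exact isUnit_natCast_of_not_dvd fun h' => h (Nat.cast_dvd_cast h')

/-- `K_k S` consists of the matrices which commute with `[[0, ε], [1, 0]]` modulo `p ^ k`. -/
lemma mem_TKS_iff {l k : ℕ} (hl : l ≠ 0) (hk : k ≠ 0) {ε : ℕ} (X : GL (Fin 2) (ZMod (p ^ l))) :
    X ∈ TKS p l ε k ↔ (p : ZMod (p ^ l)) ^ k ∣ X.val 0 0 - X.val 1 1 ∧
      (p : ZMod (p ^ l)) ^ k ∣ X.val 0 1 - ε * X.val 1 0 := by
  constructor
  · rintro ⟨Y, ⟨B, hB⟩, Z, ⟨a, b, hZ⟩, rfl⟩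
    rw [Units.val_mul, hB, hZ]
    simp only [Matrix.mul_apply, Fin.sum_univ_two, Matrix.add_apply, Matrix.smul_apply,
      smul_eq_mul, Matrix.one_apply, Matrix.of_apply, Matrix.cons_val]
    constructor
    · exact ⟨B 0 0 * a + B 0 1 * b - ε * (B 1 0 * b) - B 1 1 * a, by simp; ring⟩
    · exact ⟨B 0 0 * (ε * b) + B 0 1 * a - ε * (B 1 0 * a + B 1 1 * b), by simp; ring⟩
  · rintro ⟨⟨u, hu⟩, ⟨v, hv⟩⟩
    let M : Matrix (Fin 2) (Fin 2) (ZMod (p ^ l)) :=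
      !![X.val 1 1, ε * X.val 1 0; X.val 1 0, X.val 1 1]
    have hX : IsUnit X.val.det := (Matrix.isUnit_iff_isUnit_det _).1 X.isUnit
    have hM : IsUnit M.det := by
      apply isUnit_of_not_dvd
      rintro ⟨z, hz⟩
      refine not_isUnit_natCast_prime hl (isUnit_of_dvd_unit ?_ hX)
      obtain ⟨j, rfl⟩ := Nat.exists_eq_succ_of_ne_zero hk
      refine ⟨z + p ^ j * (u * X.val 1 1 - v * X.val 1 0), ?_⟩
      simp only [M, Matrix.det_fin_two_of] at hz
      rw [Matrix.det_fin_two]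
      rw [Nat.succ_eq_add_one] at hu hv
      linear_combination hz + X.val 1 1 * hu - X.val 1 0 * hv
    obtain ⟨Z, hZ⟩ := (Matrix.isUnit_iff_isUnit_det _).2 hM
    refine ⟨X * Z⁻¹, ⟨!![u, v; 0, 0] * Z⁻¹.val, ?_⟩, Z, ⟨_, _, hZ⟩, by group⟩
    have hXZ : X.val = Z.val + (p : ZMod (p ^ l)) ^ k • !![u, v; 0, 0] := by
      rw [hZ]
      ext i j
      fin_cases i <;> fin_cases j <;> simp [M]
      · linear_combination hu
      · linear_combination hv
    rw [Units.val_mul, hXZ, add_mul, ← Units.val_mul, mul_inv_cancel, Units.val_one,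
      Matrix.smul_mul]

lemma TKS_mul_mem {l k : ℕ} (hl : l ≠ 0) (hk : k ≠ 0) {ε : ℕ} {X Y : GL (Fin 2) (ZMod (p ^ l))}
    (hX : X ∈ TKS p l ε k) (hY : Y ∈ TKS p l ε k) : X * Y ∈ TKS p l ε k := by
  rw [mem_TKS_iff hl hk] at *
  obtain ⟨⟨u, hu⟩, ⟨v, hv⟩⟩ := hX
  obtain ⟨⟨u', hu'⟩, ⟨v', hv'⟩⟩ := hY
  simp only [Units.val_mul, Matrix.mul_apply, Fin.sum_univ_two]
  constructor
  · refine ⟨u * Y.val 0 0 + v * Y.val 1 0 + X.val 1 1 * u' - X.val 1 0 * v', ?_⟩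
    linear_combination Y.val 0 0 * hu + Y.val 1 0 * hv + X.val 1 1 * hu' - X.val 1 0 * hv'
  · refine ⟨u * Y.val 0 1 + v * Y.val 1 1 + X.val 1 1 * v' - ε * X.val 1 0 * u', ?_⟩
    linear_combination Y.val 0 1 * hu + Y.val 1 1 * hv + X.val 1 1 * hv' - ε * X.val 1 0 * hu'

lemma TKS_inv_mem {l k : ℕ} (hl : l ≠ 0) (hk : k ≠ 0) {ε : ℕ} {X : GL (Fin 2) (ZMod (p ^ l))}
    (hX : X ∈ TKS p l ε k) : X⁻¹ ∈ TKS p l ε k := by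
  rw [mem_TKS_iff hl hk] at *
  obtain ⟨⟨u, hu⟩, ⟨v, hv⟩⟩ := hX
  rw [Matrix.coe_units_inv, Matrix.inv_def, Matrix.adjugate_fin_two]
  simp only [Matrix.smul_apply, smul_eq_mul, Matrix.of_apply, Matrix.cons_val]
  generalize Ring.inverse X.val.det = D
  constructor
  · exact ⟨-(D * u), by linear_combination -D * hu⟩
  · exact ⟨-(D * v), by linear_combination -D * hv⟩

lemma one_mem_TKS {l k : ℕ} (hl : l ≠ 0) (hk : k ≠ 0) {ε : ℕ} :
    (1 : GL (Fin 2) (ZMod (p ^ l))) ∈ TKS p l ε k := by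
  rw [mem_TKS_iff hl hk]
  simp

lemma TKS_anti {l k k' : ℕ} (hl : l ≠ 0) (hk : k ≠ 0) (hkk' : k ≤ k') {ε : ℕ} :
    TKS p l ε k' ⊆ TKS p l ε k := by
  intro X hX
  rw [mem_TKS_iff hl (by omega)] at *
  exact ⟨(pow_dvd_pow _ hkk').trans hX.1, (pow_dvd_pow _ hkk').trans hX.2⟩

lemma indC_NsetOdd_eq_zero {l m ε : ℕ} (T : Set (GL (Fin 2) (ZMod (p ^ l))))
    (φ : GL (Fin 2) (ZMod (p ^ l)) → ℂ) (g : GL (Fin 2) (ZMod (p ^ l)))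
    (hg : ¬ (p : ZMod (p ^ l)) ∣ g.val 1 0) :
    indC (p ^ l) (NsetOdd p l ε m) T φ g = 0 := by
  unfold indC
  rw [Finset.sum_eq_zero, mul_zero]
  intro x _
  apply Set.indicator_apply_eq_zero.2
  intro _
  apply Set.indicator_of_notMem
  rintro ⟨a, b, c, d, h⟩
  refine hg (dvd_entry_of_conj_scalar g x a !![0, ε * b + p ^ m * c; b, p ^ m * d] ?_)
  rw [h]
  ext i j
  fin_cases i <;> fin_cases j <;> simp <;> ring

lemma indC_TKS_eq {m ε : ℕ} (hp : Odd p) (hm : 1 ≤ m) (hε : ¬ p ∣ ε)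
    (φ : GL (Fin 2) (ZMod (p ^ (2 * m + 1))) → ℂ)
    (hφmul : ∀ X Y : GL (Fin 2) (ZMod (p ^ (2 * m + 1))),
      X ∈ TKS p (2 * m + 1) ε (m + 1) → Y ∈ TKS p (2 * m + 1) ε (m + 1) →
        φ (X * Y) = φ X * φ Y)
    (hφne : ∀ X ∈ TKS p (2 * m + 1) ε (m + 1), φ X ≠ 0)
    (g : GL (Fin 2) (ZMod (p ^ (2 * m + 1))))
    (hgL : g ∈ TKS p (2 * m + 1) ε (m + 1))
    (hg : ¬ (p : ZMod (p ^ (2 * m + 1))) ∣ g.val 1 0) :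
    indC (p ^ (2 * m + 1)) (TKS p (2 * m + 1) ε (m + 1)) (TKS p (2 * m + 1) ε m) φ g = φ g := by
  classical
  have hl : 2 * m + 1 ≠ 0 := by omega
  have hm0 : m ≠ 0 := by omega
  have hm1 : m + 1 ≠ 0 := by omega
  have key : ∀ x : GL (Fin 2) (ZMod (p ^ (2 * m + 1))),
      (TKS p (2 * m + 1) ε m).indicator
        (fun y => (TKS p (2 * m + 1) ε (m + 1)).indicator φ (y * g * y⁻¹)) x =
      (TKS p (2 * m + 1) ε (m + 1)).indicator (fun _ => φ g) x := by
    intro x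
    by_cases hx : x ∈ TKS p (2 * m + 1) ε (m + 1)
    · have hxi := TKS_inv_mem hl hm1 hx
      have hxg := TKS_mul_mem hl hm1 hx hgL
      have h := TKS_mul_mem hl hm1 hxg hxi
      rw [Set.indicator_of_mem (TKS_anti hl hm0 (Nat.le_succ m) hx), Set.indicator_of_mem h,
        Set.indicator_of_mem hx]
      apply mul_right_cancel₀ (hφne x hx)
      rw [← hφmul _ _ h hx, inv_mul_cancel_right, hφmul _ _ hx hgL, mul_comm]
    · rw [Set.indicator_of_notMem hx]
      apply Set.indicator_apply_eq_zero.2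
      intro hxT
      apply Set.indicator_of_notMem
      intro h
      apply hx
      rw [mem_TKS_iff hl hm1] at hgL h ⊢
      rw [mem_TKS_iff hl hm0] at hxT
      have hp2 : ¬ p ∣ 2 := fun h2 => by
        have := (Nat.prime_dvd_prime_iff_eq Fact.out Nat.prime_two).1 h2
        subst this
        exact absurd hp (by decide)
      refine dvd_of_conj_entries hm isUnit_of_not_dvd (not_isUnit_natCast_prime hl)
        (by exact_mod_cast isUnit_natCast_of_not_dvd hp2)
        (isUnit_natCast_of_not_dvd hε) g.val (x * g * x⁻¹).val x.val
        ((Matrix.isUnit_iff_isUnit_det _).1 x.isUnit) (isUnit_of_not_dvd _ hg) ?_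
        hgL.1 hgL.2 h.1 h.2 hxT.1 hxT.2
      rw [← Units.val_mul, ← Units.val_mul, inv_mul_cancel_right]
  unfold indC
  rw [Finset.sum_congr rfl fun x _ => key x, Finset.sum_indicator_eq_sum_filter,
    Finset.sum_const, nsmul_eq_mul, ← mul_assoc]
  have hcard : Nat.card (TKS p (2 * m + 1) ε (m + 1)) =
      (Finset.univ.filter (· ∈ TKS p (2 * m + 1) ε (m + 1))).card := by
    rw [Nat.card_eq_fintype_card, Fintype.card_subtype]
  rw [← hcard, inv_mul_cancel₀, one_mul]
  rw [Nat.cast_ne_zero, hcard, Finset.card_ne_zero]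
  exact ⟨1, by simpa using one_mem_TKS hl hm1⟩

end PrimePower

/-- Distinctness claim of Lemma 3.4: if two extensions `φ, φ'` of `φ_{A₀}` to `L`
whose restrictions to `N_{m+1}` are `T`-stable give the same class function
`ψ_φ = (1/p)·Ind_{N_{m+1}}^{T}(φ|_{N_{m+1}}) − Ind_{L}^{T} φ`, then `φ = φ'` on `L`. -/
theorem lemma_3_4_distinct (p m : ℕ) [Fact p.Prime] (hp : Odd p) (hm : 1 ≤ m)
    (ε : ℕ) (hε : ε < p ^ m) (hres : ¬ IsSquare (ε : ZMod p))
    (φ φ' : GL (Fin 2) (ZMod (p ^ (2 * m + 1))) → ℂ)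
    (hφmul : ∀ X Y : GL (Fin 2) (ZMod (p ^ (2 * m + 1))),
      X ∈ TKS p (2 * m + 1) ε (m + 1) → Y ∈ TKS p (2 * m + 1) ε (m + 1) →
        φ (X * Y) = φ X * φ Y)
    (hφne : ∀ X ∈ TKS p (2 * m + 1) ε (m + 1), φ X ≠ 0)
    (hφK : ∀ X ∈ Kset p (2 * m + 1) (m + 1),
      φ X = phiA p (2 * m + 1)
        !![(0 : ZMod (p ^ (2 * m + 1))), (ε : ZMod (p ^ (2 * m + 1))); 1, 0] X)
    (hφstab : ∀ t ∈ TKS p (2 * m + 1) ε m, ∀ X ∈ NsetOdd p (2 * m + 1) ε m,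
      φ (t * X * t⁻¹) = φ X)
    (hφ'mul : ∀ X Y : GL (Fin 2) (ZMod (p ^ (2 * m + 1))),
      X ∈ TKS p (2 * m + 1) ε (m + 1) → Y ∈ TKS p (2 * m + 1) ε (m + 1) →
        φ' (X * Y) = φ' X * φ' Y)
    (hφ'ne : ∀ X ∈ TKS p (2 * m + 1) ε (m + 1), φ' X ≠ 0)
    (hφ'K : ∀ X ∈ Kset p (2 * m + 1) (m + 1),
      φ' X = phiA p (2 * m + 1)
        !![(0 : ZMod (p ^ (2 * m + 1))), (ε : ZMod (p ^ (2 * m + 1))); 1, 0] X)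
    (hφ'stab : ∀ t ∈ TKS p (2 * m + 1) ε m, ∀ X ∈ NsetOdd p (2 * m + 1) ε m,
      φ' (t * X * t⁻¹) = φ' X)
    (heq : ∀ g : GL (Fin 2) (ZMod (p ^ (2 * m + 1))),
      (1 / (p : ℂ)) *
            indC (p ^ (2 * m + 1)) (NsetOdd p (2 * m + 1) ε m) (TKS p (2 * m + 1) ε m) φ g -
          indC (p ^ (2 * m + 1)) (TKS p (2 * m + 1) ε (m + 1)) (TKS p (2 * m + 1) ε m) φ g =
        (1 / (p : ℂ)) *
            indC (p ^ (2 * m + 1)) (NsetOdd p (2 * m + 1) ε m) (TKS p (2 * m + 1) ε m) φ' g -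
          indC (p ^ (2 * m + 1)) (TKS p (2 * m + 1) ε (m + 1)) (TKS p (2 * m + 1) ε m) φ' g) :
    ∀ X ∈ TKS p (2 * m + 1) ε (m + 1), φ X = φ' X := by
  have hl : 2 * m + 1 ≠ 0 := by omega
  have hm1 : m + 1 ≠ 0 := by omega
  have hpε : ¬ p ∣ ε := fun h => hres (by
    rw [(ZMod.natCast_eq_zero_iff ε p).2 h]
    exact IsSquare.zero)
  have hoff : ∀ g ∈ TKS p (2 * m + 1) ε (m + 1),
      ¬ (p : ZMod (p ^ (2 * m + 1))) ∣ g.val 1 0 → φ g = φ' g := by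
    intro g hgL hg
    have h := heq g
    rw [indC_NsetOdd_eq_zero _ _ _ hg, indC_NsetOdd_eq_zero _ _ _ hg,
      indC_TKS_eq hp hm hpε φ hφmul hφne g hgL hg,
      indC_TKS_eq hp hm hpε φ' hφ'mul hφ'ne g hgL hg] at h
    linear_combination -h
  intro X hX
  by_cases hd : (p : ZMod (p ^ (2 * m + 1))) ∣ X.val 1 0
  · obtain ⟨W, hW⟩ : IsUnit
        !![(0 : ZMod (p ^ (2 * m + 1))), (ε : ZMod (p ^ (2 * m + 1))); 1, 0] := by
      rw [Matrix.isUnit_iff_isUnit_det, Matrix.det_fin_two_of]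
      simpa using isUnit_natCast_of_not_dvd hpε
    have hWL : W ∈ TKS p (2 * m + 1) ε (m + 1) := by
      rw [mem_TKS_iff hl hm1, hW]
      simp
    have hpu := not_isUnit_natCast_prime (p := p) hl
    have h1 := hoff W hWL (by
      rw [hW]
      simpa using fun h => hpu (isUnit_of_dvd_one h))
    have h2 := hoff (X * W) (TKS_mul_mem hl hm1 hX hWL) (by
      rw [Units.val_mul, hW, Matrix.mul_apply, Fin.sum_univ_two]
      intro h
      have h11 : (p : ZMod (p ^ (2 * m + 1))) ∣ X.val 1 1 := by simpa using h
      refine hpu (isUnit_of_dvd_unit ?_ ((Matrix.isUnit_iff_isUnit_det _).1 X.isUnit))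
      rw [Matrix.det_fin_two]
      exact dvd_sub (h11.mul_left _) (hd.mul_left _))
    rw [hφmul _ _ hX hWL, hφ'mul _ _ hX hWL, ← h1] at h2
    exact mul_right_cancel₀ (hφne W hWL) h2
  · exact hoff X hX hd
end
end
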